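/- Let n ≥ 2 and consider the type B_n root system in ℝⁿ with its standard inner product: Φ = {±e_i ± e_j : 1 ≤ i ≠ j ≤ n} ∪ {±e_i : 1 ≤ i ≤ n}, with positive roots Φ⁺ = {e_i ± e_j : 1 ≤ i < j ≤ n} ∪ {e_i : 1 ≤ i ≤ n} and simple roots Δ = {e_i − e_{i+1} : 1 ≤ i ≤ n−1} ∪ {e_n}. Let W be the Weyl group (the subgroup of GL(ℝⁿ) generated by the reflections s_α, α ∈ Φ) and let C = W_D^A for some D ⊆ A ⊆ Φ⁺ with |C| > 1. Then there exists β ∈ Φ⁺ with 1/(2e) ≤ δ_C(β) ≤ 1 − 1/(2e); that is, the balance constant satisfies b(C) ≥ 1/(2e). -/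

import Mathlib

open InnerProductSpace

noncomputable section

/-- The standard basis vector `e_i` of `ℝⁿ`. -/
def eB (n : ℕ) (i : Fin n) : EuclideanSpace ℝ (Fin n) := EuclideanSpace.single i 1

/-- The positive roots of the type `Bₙ` root system:
`Φ⁺ = {e_i ± e_j : i < j} ∪ {e_i}`. -/
def posB (n : ℕ) : Set (EuclideanSpace ℝ (Fin n)) :=
  {x | ∃ i j : Fin n, i < j ∧ (x = eB n i - eB n j ∨ x = eB n i + eB n j)} ∪
    {x | ∃ i : Fin n, x = eB n i}

/-- The type `Bₙ` root system `Φ = {±e_i ± e_j : i ≠ j} ∪ {±e_i} = Φ⁺ ∪ (−Φ⁺)`. -/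
def rootsB (n : ℕ) : Set (EuclideanSpace ℝ (Fin n)) := posB n ∪ -posB n

/-- The Weyl group of type `Bₙ`: the subgroup of `GL(ℝⁿ)` generated by the reflections
`s_α(x) = x − (2⟨α,x⟩/⟨α,α⟩)α` for `α ∈ Φ`. -/
def weylB (n : ℕ) : Subgroup (EuclideanSpace ℝ (Fin n) ≃ₗ[ℝ] EuclideanSpace ℝ (Fin n)) :=
  Subgroup.closure
    {g | ∃ α ∈ rootsB n, ∀ x, g x = x - (2 * ⟪α, x⟫_ℝ / ⟪α, α⟫_ℝ) • α}

/-- The inversion set `I(w) = {α ∈ Φ⁺ : wα ∈ −Φ⁺}`. -/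
def invB (n : ℕ) (w : EuclideanSpace ℝ (Fin n) ≃ₗ[ℝ] EuclideanSpace ℝ (Fin n)) :
    Set (EuclideanSpace ℝ (Fin n)) :=
  {α ∈ posB n | -(w α) ∈ posB n}

/-- The convex subset `W_D^A = {w ∈ W : D ⊆ I(w) ⊆ A}`. -/
def convexB (n : ℕ) (D A : Set (EuclideanSpace ℝ (Fin n))) :
    Set (EuclideanSpace ℝ (Fin n) ≃ₗ[ℝ] EuclideanSpace ℝ (Fin n)) :=
  {w | w ∈ weylB n ∧ D ⊆ invB n w ∧ invB n w ⊆ A}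

/-- `δ_C(α) = |C_α|/|C|`. -/
def deltaB (n : ℕ) (C : Set (EuclideanSpace ℝ (Fin n) ≃ₗ[ℝ] EuclideanSpace ℝ (Fin n)))
    (α : EuclideanSpace ℝ (Fin n)) : ℝ :=
  ({w ∈ C | -(w α) ∈ posB n}.ncard : ℝ) / (C.ncard : ℝ)

end

section PrekopaLeindler

open MeasureTheory Set
open scoped ENNReal Pointwise

/-- The one-dimensional Brunn–Minkowski inequality for compact sets. -/
theorem volume_add_le_of_isCompact {A B C : Set ℝ} (hA : IsCompact A) (hB : IsCompact B)
    (hA0 : A.Nonempty) (hB0 : B.Nonempty) (h : ∀ x ∈ A, ∀ y ∈ B, x + y ∈ C) :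
    volume A + volume B ≤ volume C := by
  obtain ⟨m, hm, hmax⟩ := hA.exists_isGreatest hA0
  obtain ⟨k, hk, hmin⟩ := hB.exists_isLeast hB0
  have h1 : volume ((fun x => x + k) '' A) = volume A := by
    simp
  have h2 : volume ((fun x => m + x) '' B) = volume B := by
    simp
  have h3 : AEDisjoint volume ((fun x => x + k) '' A) ((fun x => m + x) '' B) := by
    refine measure_mono_null (t := {m + k}) ?_ (by simp)
    rintro z ⟨⟨x, hx, rfl⟩, ⟨y, hy, hxy⟩⟩
    have := hmax hx
    have := hmin hy
    simp only at hxy ⊢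
    simp only [mem_singleton_iff]
    linarith
  have hmeas : MeasurableSet ((fun x => m + x) '' B) :=
    (hB.image (by fun_prop)).measurableSet
  rw [← h1, ← h2, ← measure_union₀ hmeas.nullMeasurableSet h3]
  apply measure_mono
  rintro z (⟨x, hx, rfl⟩ | ⟨x, hx, rfl⟩)
  · exact h x hx k hk
  · exact h m hm x hx

/-- The one-dimensional Brunn–Minkowski inequality for measurable sets. -/
theorem volume_add_le {A B C : Set ℝ} (hA : MeasurableSet A) (hB : MeasurableSet B)
    (hA0 : A.Nonempty) (hB0 : B.Nonempty) (h : ∀ x ∈ A, ∀ y ∈ B, x + y ∈ C) :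
    volume A + volume B ≤ volume C := by
  obtain ⟨x₀, hx₀⟩ := hA0
  obtain ⟨y₀, hy₀⟩ := hB0
  have key : ∀ K ⊆ A, IsCompact K → ∀ L ⊆ B, IsCompact L → volume K + volume L ≤ volume C := by
    intro K hKA hK L hLB hL
    refine le_trans ?_ (volume_add_le_of_isCompact (hK.insert x₀) (hL.insert y₀)
      ⟨x₀, mem_insert _ _⟩ ⟨y₀, mem_insert _ _⟩ ?_)
    · exact add_le_add (measure_mono (subset_insert _ _)) (measure_mono (subset_insert _ _))
    · intro x hx y hy
      exact h x (insert_subset hx₀ hKA hx) y (insert_subset hy₀ hLB hy)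
  rw [hA.measure_eq_iSup_isCompact, hB.measure_eq_iSup_isCompact]
  simp only [iSup_and']
  refine ENNReal.biSup_add_biSup_le' (p := fun K => K ⊆ A ∧ IsCompact K)
    (q := fun K => K ⊆ B ∧ IsCompact K) ⟨∅, by simp⟩ ⟨∅, by simp⟩ ?_
  intro K hK L hL
  exact key K hK.1 hK.2 L hL.1 hL.2

theorem weighted_volume_add_le {A B C : Set ℝ} (hA : MeasurableSet A) (hB : MeasurableSet B)
    (hA0 : A.Nonempty) (hB0 : B.Nonempty) {a b : ℝ} (ha : 0 < a) (hb : 0 < b)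
    (h : ∀ x ∈ A, ∀ y ∈ B, a * x + b * y ∈ C) :
    ENNReal.ofReal a * volume A + ENNReal.ofReal b * volume B ≤ volume C := by
  have h1 : ∀ {c : ℝ} (_ : 0 < c) (S : Set ℝ), volume (c • S) = ENNReal.ofReal c * volume S := by
    intro c hc S
    rw [Measure.addHaar_smul]
    simp [abs_of_pos hc]
  rw [← h1 ha, ← h1 hb]
  refine volume_add_le (hA.const_smul₀ a) (hB.const_smul₀ b) hA0.smul_set hB0.smul_set ?_
  rintro _ ⟨x, hx, rfl⟩ _ ⟨y, hy, rfl⟩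
  exact h x hx y hy

theorem ENNReal.rpow_mul_rpow_le_add {a b : ℝ} (ha : 0 < a) (hb : 0 < b) (hab : a + b = 1)
    (x y : ℝ≥0∞) :
    x ^ a * y ^ b ≤ ENNReal.ofReal a * x + ENNReal.ofReal b * y := by
  have hc : (a⁻¹).HolderConjugate b⁻¹ := by
    rw [Real.holderConjugate_iff]
    refine ⟨(one_lt_inv₀ ha).2 (by linarith), by simpa using hab⟩
  refine (ENNReal.young_inequality (x ^ a) (y ^ b) hc).trans (le_of_eq ?_)
  rw [← ENNReal.rpow_mul, ← ENNReal.rpow_mul, mul_inv_cancel₀ ha.ne', mul_inv_cancel₀ hb.ne',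
    ENNReal.rpow_one, ENNReal.rpow_one, ENNReal.ofReal_inv_of_pos ha, ENNReal.ofReal_inv_of_pos hb,
    div_eq_mul_inv, div_eq_mul_inv, inv_inv, inv_inv, mul_comm x, mul_comm y]

theorem lintegral_eq_lintegral_Ioo_meas_lt {f : ℝ → ℝ≥0∞} (hf : Measurable f) (hf1 : ∀ x, f x ≤ 1) :
    ∫⁻ x, f x = ∫⁻ t in Ioo (0 : ℝ) 1, volume {x | ENNReal.ofReal t < f x} := by
  have hfin : ∀ x, f x ≠ ∞ := fun x => ((hf1 x).trans_lt ENNReal.one_lt_top).ne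
  have h1 : ∫⁻ x, f x = ∫⁻ x, ENNReal.ofReal (f x).toReal :=
    lintegral_congr fun x => (ENNReal.ofReal_toReal (hfin x)).symm
  rw [h1, lintegral_eq_lintegral_meas_lt volume (Filter.Eventually.of_forall fun x => by positivity)
    hf.ennreal_toReal.aemeasurable]
  have h2 : ∀ t ∈ Ioi (0 : ℝ), volume {x | t < (f x).toReal} =
      volume {x | ENNReal.ofReal t < f x} := by
    intro t ht
    congr 1
    ext x
    exact (ENNReal.ofReal_lt_iff_lt_toReal (le_of_lt ht) (hfin x)).symm
  rw [setLIntegral_congr_fun measurableSet_Ioi h2, ← Ioo_union_Ici_eq_Ioi (zero_lt_one (α := ℝ)),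
    lintegral_union measurableSet_Ici]
  · conv_rhs => rw [← add_zero (lintegral _ _)]
    congr 1
    rw [setLIntegral_congr_fun (g := fun _ => 0) measurableSet_Ici, lintegral_zero]
    intro t ht
    have : {x | ENNReal.ofReal t < f x} = ∅ := by
      ext x
      simp only [mem_ofPred_eq, mem_empty_iff_false, iff_false, not_lt]
      exact (hf1 x).trans (by simpa using ht)
    simp [this]
  · exact disjoint_left.2 fun x hx hx' => not_lt.2 hx' hx.2

theorem lintegral_add_le_of_iSup_eq_one {f g h : ℝ → ℝ≥0∞} (hf : Measurable f) (hg : Measurable g)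
    (hh : Measurable h) (hf1 : ⨆ x, f x = 1) (hg1 : ⨆ x, g x = 1) {a b : ℝ} (ha : 0 < a)
    (hb : 0 < b) (hab : a + b = 1) (H : ∀ x y, f x ^ a * g y ^ b ≤ h (a * x + b * y)) :
    ENNReal.ofReal a * (∫⁻ x, f x) + ENNReal.ofReal b * (∫⁻ x, g x) ≤ ∫⁻ x, h x := by
  have hf2 : ∀ x, f x ≤ 1 := fun x => hf1 ▸ le_iSup f x
  have hg2 : ∀ x, g x ≤ 1 := fun x => hg1 ▸ le_iSup g x
  refine le_trans ?_ (lintegral_mono (f := fun x => min (h x) 1) fun x => min_le_left _ _)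
  rw [lintegral_eq_lintegral_Ioo_meas_lt hf hf2, lintegral_eq_lintegral_Ioo_meas_lt hg hg2,
    lintegral_eq_lintegral_Ioo_meas_lt (hh.min measurable_const) fun x => min_le_right _ _]
  have hmono : ∀ k : ℝ → ℝ≥0∞, Antitone fun t : ℝ => volume {x | ENNReal.ofReal t < k x} := by
    intro k s t hst
    exact measure_mono fun x hx => (ENNReal.ofReal_le_ofReal hst).trans_lt hx
  rw [← lintegral_const_mul _ (hmono f).measurable, ← lintegral_const_mul _ (hmono g).measurable,
    ← lintegral_add_left ((hmono f).measurable.const_mul _)]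
  refine setLIntegral_mono' measurableSet_Ioo fun t ht => ?_
  have ht1 : ENNReal.ofReal t < 1 := by
    rw [← ENNReal.ofReal_one]
    exact (ENNReal.ofReal_lt_ofReal_iff one_pos).2 ht.2
  have hne : ∀ k : ℝ → ℝ≥0∞, ⨆ x, k x = 1 → (k ⁻¹' Ioi (ENNReal.ofReal t)).Nonempty :=
    fun k hk => by
      obtain ⟨x, hx⟩ := lt_iSup_iff.1 (hk.symm ▸ ht1)
      exact ⟨x, hx⟩
  refine weighted_volume_add_le (hf measurableSet_Ioi) (hg measurableSet_Ioi)
    (hne f hf1) (hne g hg1) ha hb ?_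
  intro x hx y hy
  refine lt_min (lt_of_lt_of_le ?_ (H x y)) ht1
  have e : ENNReal.ofReal t = ENNReal.ofReal t ^ a * ENNReal.ofReal t ^ b := by
    rw [← ENNReal.rpow_add_of_nonneg _ _ ha.le hb.le, hab, ENNReal.rpow_one]
  rw [e]
  exact ENNReal.mul_lt_mul (ENNReal.rpow_lt_rpow hx ha) (ENNReal.rpow_lt_rpow hy hb)

theorem prekopa_leindler_of_bounded {f g h : ℝ → ℝ≥0∞} (hf : Measurable f) (hg : Measurable g)
    (hh : Measurable h) (hf1 : ⨆ x, f x ≠ ∞) (hg1 : ⨆ x, g x ≠ ∞) {a b : ℝ} (ha : 0 < a)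
    (hb : 0 < b) (hab : a + b = 1) (H : ∀ x y, f x ^ a * g y ^ b ≤ h (a * x + b * y)) :
    (∫⁻ x, f x) ^ a * (∫⁻ x, g x) ^ b ≤ ∫⁻ x, h x := by
  set M := ⨆ x, f x with hM
  set N := ⨆ x, g x with hN
  rcases eq_or_ne M 0 with hM0 | hM0
  · have : f = 0 := by
      ext x
      exact le_zero_iff.1 (hM0 ▸ le_iSup f x)
    simp [this, ha]
  rcases eq_or_ne N 0 with hN0 | hN0
  · have : g = 0 := by
      ext x
      exact le_zero_iff.1 (hN0 ▸ le_iSup g x)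
    simp [this, hb]
  have key := lintegral_add_le_of_iSup_eq_one (f := fun x => M⁻¹ * f x) (g := fun x => N⁻¹ * g x)
    (h := fun x => ((M⁻¹) ^ a * (N⁻¹) ^ b) * h x) (hf.const_mul _) (hg.const_mul _)
    (hh.const_mul _)
    (by rw [← ENNReal.mul_iSup, ENNReal.inv_mul_cancel hM0 hf1])
    (by rw [← ENNReal.mul_iSup, ENNReal.inv_mul_cancel hN0 hg1]) ha hb hab (by
      intro x y
      rw [ENNReal.mul_rpow_of_nonneg _ _ ha.le, ENNReal.mul_rpow_of_nonneg _ _ hb.le,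
        mul_mul_mul_comm]
      gcongr
      exact H x y)
  have key2 := (ENNReal.rpow_mul_rpow_le_add ha hb hab _ _).trans key
  rw [lintegral_const_mul _ hf, lintegral_const_mul _ hg, lintegral_const_mul _ hh,
    ENNReal.mul_rpow_of_nonneg _ _ ha.le, ENNReal.mul_rpow_of_nonneg _ _ hb.le,
    mul_mul_mul_comm] at key2
  refine (ENNReal.mul_le_mul_iff_right ?_ ?_).1 key2
  · have h1 := ENNReal.rpow_pos (p := a) (ENNReal.inv_pos.2 hf1) (ENNReal.inv_ne_top.2 hM0)
    have h2 := ENNReal.rpow_pos (p := b) (ENNReal.inv_pos.2 hg1) (ENNReal.inv_ne_top.2 hN0)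
    exact (ENNReal.mul_pos h1.ne' h2.ne').ne'
  · exact ENNReal.mul_ne_top (ENNReal.rpow_ne_top_of_nonneg ha.le (ENNReal.inv_ne_top.2 hM0))
      (ENNReal.rpow_ne_top_of_nonneg hb.le (ENNReal.inv_ne_top.2 hN0))

theorem lintegral_eq_iSup_min_nat {f : ℝ → ℝ≥0∞} (hf : Measurable f) :
    ∫⁻ x, f x = ⨆ k : ℕ, ∫⁻ x, min (f x) k := by
  rw [← lintegral_iSup (fun k => hf.min measurable_const)]
  · refine lintegral_congr fun x => ?_
    rw [← inf_iSup_eq, ENNReal.iSup_natCast]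
    simp
  · intro i j hij x
    exact min_le_min le_rfl (by exact_mod_cast hij)

/-- The one-dimensional Prékopa–Leindler inequality. -/
theorem prekopa_leindler_real {f g h : ℝ → ℝ≥0∞} (hf : Measurable f) (hg : Measurable g)
    (hh : Measurable h) {a b : ℝ} (ha : 0 < a)
    (hb : 0 < b) (hab : a + b = 1) (H : ∀ x y, f x ^ a * g y ^ b ≤ h (a * x + b * y)) :
    (∫⁻ x, f x) ^ a * (∫⁻ x, g x) ^ b ≤ ∫⁻ x, h x := by
  rw [lintegral_eq_iSup_min_nat hf, lintegral_eq_iSup_min_nat hg]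
  have e1 : ∀ {c : ℝ} (hc : 0 < c) (u : ℕ → ℝ≥0∞), (⨆ k, u k) ^ c = ⨆ k, u k ^ c := by
    intro c hc u
    exact (ENNReal.orderIsoRpow c hc).map_iSup u
  rw [e1 ha, e1 hb]
  rw [ENNReal.iSup_mul]
  refine iSup_le fun i => ?_
  rw [ENNReal.mul_iSup]
  refine iSup_le fun j => ?_
  have hb' : ∀ (k : ℝ → ℝ≥0∞) (i : ℕ), ⨆ x, min (k x) i ≠ ∞ := fun k i =>
    ((iSup_le fun x => min_le_right _ _).trans_lt (ENNReal.natCast_lt_top i)).ne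
  refine prekopa_leindler_of_bounded (hf.min measurable_const) (hg.min measurable_const) hh
    (hb' f i) (hb' g j) ha hb hab fun x y => le_trans ?_ (H x y)
  gcongr <;> exact min_le_left _ _

theorem lintegral_fin_succ {n : ℕ} {f : (Fin (n + 1) → ℝ) → ℝ≥0∞} (hf : Measurable f) :
    ∫⁻ x, f x = ∫⁻ t : ℝ, ∫⁻ y : Fin n → ℝ, f (Fin.cons t y) := by
  have e := (volume_preserving_piFinSuccAbove (fun _ : Fin (n + 1) => ℝ) 0).symm
  rw [← e.lintegral_comp_emb (MeasurableEquiv.measurableEmbedding _), Measure.volume_eq_prod,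
    lintegral_prod]
  · refine lintegral_congr fun t => lintegral_congr fun y => ?_
    congr 1
    ext i
    refine Fin.cases ?_ (fun j => ?_) i <;> simp [MeasurableEquiv.piFinSuccAbove]
  · exact (hf.comp (MeasurableEquiv.measurable _)).aemeasurable

/-- The Prékopa–Leindler inequality. -/
theorem prekopa_leindler {a b : ℝ} (ha : 0 < a) (hb : 0 < b) (hab : a + b = 1) :
    ∀ {n : ℕ} {f g h : (Fin n → ℝ) → ℝ≥0∞}, Measurable f → Measurable g → Measurable h →
      (∀ x y, f x ^ a * g y ^ b ≤ h (a • x + b • y)) →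
      (∫⁻ x, f x) ^ a * (∫⁻ x, g x) ^ b ≤ ∫⁻ x, h x := by
  intro n
  induction n with
  | zero =>
    intro f g h _ _ _ H
    have e : ∀ k : (Fin 0 → ℝ) → ℝ≥0∞, ∫⁻ x, k x = k 0 := by
      intro k
      rw [lintegral_unique, volume_pi, Measure.pi_of_empty]
      simp only [Measure.dirac_apply_of_mem (mem_univ _), mul_one]
      congr 1
      exact Subsingleton.elim _ _
    rw [e, e, e]
    simpa using H 0 0
  | succ n ih =>
    intro f g h hf hg hh H
    have hm : ∀ {k : (Fin (n + 1) → ℝ) → ℝ≥0∞}, Measurable k →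
        Measurable fun p : ℝ × (Fin n → ℝ) => k (Fin.cons p.1 p.2) := by
      intro k hk
      refine hk.comp (measurable_pi_lambda _ fun i => ?_)
      refine Fin.cases ?_ (fun j => ?_) i
      · simpa using measurable_fst
      · simp only [Fin.cons_succ]
        fun_prop
    rw [lintegral_fin_succ hf, lintegral_fin_succ hg, lintegral_fin_succ hh]
    refine prekopa_leindler_real (hm hf).lintegral_prod_right (hm hg).lintegral_prod_right
      (hm hh).lintegral_prod_right ha hb hab fun x y => ?_
    refine ih ((hm hf).comp measurable_prodMk_left) ((hm hg).comp measurable_prodMk_left)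
      ((hm hh).comp measurable_prodMk_left) fun u v => ?_
    refine (H _ _).trans (le_of_eq ?_)
    congr 1
    ext i
    refine Fin.cases ?_ (fun j => ?_) i <;> simp

/-- The multiplicative Brunn–Minkowski inequality. -/
theorem volume_rpow_mul_le {n : ℕ} {A B C : Set (EuclideanSpace ℝ (Fin n))} (hA : MeasurableSet A)
    (hB : MeasurableSet B) (hC : MeasurableSet C) {a b : ℝ} (ha : 0 < a) (hb : 0 < b)
    (hab : a + b = 1) (h : ∀ x ∈ A, ∀ y ∈ B, a • x + b • y ∈ C) :
    volume A ^ a * volume B ^ b ≤ volume C := by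
  have e := (EuclideanSpace.volume_preserving_symm_measurableEquiv_toLp (Fin n)).symm
  have hv : ∀ {S : Set (EuclideanSpace ℝ (Fin n))}, MeasurableSet S →
      volume S = ∫⁻ x : Fin n → ℝ, S.indicator 1 (WithLp.toLp 2 x) := by
    intro S hS
    rw [← lintegral_indicator_one hS, ← 
      e.lintegral_comp_emb (MeasurableEquiv.measurableEmbedding _)]
    rfl
  have hme : Measurable fun x : Fin n → ℝ => (WithLp.toLp 2 x : EuclideanSpace ℝ (Fin n)) :=
    e.measurable
  rw [hv hA, hv hB, hv hC]
  refine prekopa_leindler ha hb hab ((measurable_one.indicator hA).comp hme)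
    ((measurable_one.indicator hB).comp hme) ((measurable_one.indicator hC).comp hme) ?_
  intro x y
  by_cases hx : WithLp.toLp 2 x ∈ A
  · by_cases hy : WithLp.toLp 2 y ∈ B
    · have := h _ hx _ hy
      simp only [WithLp.toLp_add, WithLp.toLp_smul]
      simp [hx, hy, this]
    · simp [hy, hb]
  · simp [hx, ha]

end PrekopaLeindler

section HalfSpace

open MeasureTheory Set InnerProductSpace

/-- A monotone log-concave function has an exponential supporting function at `0`, whose rate
is at most `n` if the function dominates an `n`-th power on the left of `0`. -/
theorem exists_exp_support {n : ℕ} {F : ℝ → ℝ} (hmono : Monotone F) (h0 : 0 < F 0)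
    (hF0 : ∀ t, 0 ≤ F t)
    (hlog : ∀ s t a b : ℝ, 0 < a → 0 < b → a + b = 1 → F s ^ a * F t ^ b ≤ F (a * s + b * t))
    (hleft : ∀ s ∈ Ioo (0 : ℝ) 1, (1 - s) ^ n * F 0 ≤ F (-s)) :
    ∃ κ : ℝ, 0 ≤ κ ∧ κ ≤ n ∧ ∀ t, F t ≤ F 0 * Real.exp (κ * t) := by
  set S : Set ℝ := {m | ∃ s, 0 < s ∧ 0 < F (-s) ∧ m = (Real.log (F 0) - Real.log (F (-s))) / s}
    with hS
  have hpos : ∀ s ∈ Ioo (0 : ℝ) 1, 0 < F (-s) := fun s hs =>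
    lt_of_lt_of_le (mul_pos (pow_pos (by linarith [hs.2]) n) h0) (hleft s hs)
  have hmem : ∀ s ∈ Ioo (0 : ℝ) 1, (Real.log (F 0) - Real.log (F (-s))) / s ∈ S := fun s hs =>
    ⟨s, hs.1, hpos s hs, rfl⟩
  have hne : S.Nonempty := ⟨_, hmem (1 / 2) ⟨by norm_num, by norm_num⟩⟩
  have hlb : ∀ m ∈ S, 0 ≤ m := by
    rintro m ⟨s, hs, hFs, rfl⟩
    refine div_nonneg (sub_nonneg.2 (Real.log_le_log hFs (hmono (by linarith)))) hs.le
  have hbdd : BddBelow S := ⟨0, hlb⟩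
  refine ⟨sInf S, le_csInf hne hlb, ?_, ?_⟩
  · have key : ∀ s ∈ Ioo (0 : ℝ) 1, sInf S * (1 - s) ≤ n := by
      intro s hs
      have hs1 : 0 < 1 - s := by linarith [hs.2]
      have h1 := csInf_le hbdd (hmem s hs)
      have h2 : Real.log (F (-s)) ≥ n * Real.log (1 - s) + Real.log (F 0) := by
        rw [← Real.log_pow, ← Real.log_mul (pow_pos hs1 n).ne' h0.ne']
        exact Real.log_le_log (mul_pos (pow_pos hs1 n) h0) (hleft s hs)
      have h3 := Real.one_sub_inv_le_log_of_pos hs1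
      rw [le_div_iff₀ hs.1] at h1
      have h4 : (n : ℝ) * (1 - (1 - s)⁻¹) ≤ n * Real.log (1 - s) :=
        mul_le_mul_of_nonneg_left h3 (Nat.cast_nonneg n)
      have h5 : sInf S * s ≤ n * ((1 - s)⁻¹ - 1) := by linarith
      have h6 : (1 - s)⁻¹ - 1 = s * (1 - s)⁻¹ := by field_simp; ring
      rw [h6] at h5
      have h7 : sInf S ≤ n * (1 - s)⁻¹ := by
        refine le_of_mul_le_mul_right ?_ hs.1
        linarith
      calc sInf S * (1 - s) ≤ (n * (1 - s)⁻¹) * (1 - s) := mul_le_mul_of_nonneg_right h7 hs1.le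
        _ = n := by field_simp
    by_contra! hlt
    have hκ : 0 < sInf S := lt_of_le_of_lt (Nat.cast_nonneg n) hlt
    have := key ((sInf S - n) / (2 * sInf S)) ⟨by apply div_pos <;> linarith, by
      rw [div_lt_one (by linarith)]
      have : (0 : ℝ) ≤ n := Nat.cast_nonneg n
      linarith⟩
    have h8 : sInf S * (1 - (sInf S - n) / (2 * sInf S)) = (sInf S + n) / 2 := by
      field_simp; ring
    linarith
  · intro t
    rcases (hF0 t).eq_or_lt with hFt | hFt
    · rw [← hFt]
      positivity
    rw [← Real.log_le_log_iff hFt (by positivity), Real.log_mul h0.ne' (Real.exp_ne_zero _),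
      Real.log_exp]
    rcases lt_trichotomy t 0 with ht | rfl | ht
    · have h1 := csInf_le hbdd (show (Real.log (F 0) - Real.log (F (-(-t)))) / (-t) ∈ S from
        ⟨-t, by linarith, by simpa using hFt, rfl⟩)
      rw [neg_neg, le_div_iff₀ (by linarith)] at h1
      linarith
    · simp
    · have h1 : (Real.log (F t) - Real.log (F 0)) / t ≤ sInf S := by
        refine le_csInf hne ?_
        rintro m ⟨s, hs, hFs, rfl⟩
        have hst : 0 < s + t := by linarith
        have h2 := hlog (-s) t (t / (s + t)) (s / (s + t)) (by positivity) (by positivity)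
          (by field_simp; ring)
        have h3 : t / (s + t) * -s + s / (s + t) * t = 0 := by field_simp; ring
        rw [h3] at h2
        have h4 := Real.log_le_log (by positivity) h2
        rw [Real.log_mul (by positivity) (by positivity), Real.log_rpow hFs,
          Real.log_rpow hFt] at h4
        rw [div_le_div_iff₀ ht hs]
        have h5 : t * Real.log (F (-s)) + s * Real.log (F t) ≤ (s + t) * Real.log (F 0) := by
          have := mul_le_mul_of_nonneg_left h4 hst.le
          calc _ = (s + t) * (t / (s + t) * Real.log (F (-s)) + s / (s + t) * Real.log (F t)) := by
                field_simp
            _ ≤ _ := this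
        linarith
      rw [div_le_iff₀ ht] at h1
      linarith

theorem integral_exp_mul {κ : ℝ} (hκ : κ ≠ 0) (a b : ℝ) :
    ∫ t in a..b, Real.exp (κ * t) = (Real.exp (κ * b) - Real.exp (κ * a)) / κ := by
  rw [intervalIntegral.integral_comp_mul_left (fun x => Real.exp x) hκ, integral_exp]
  simp only [smul_eq_mul]
  field_simp

/-- A Grünbaum-type bound: the mass below `0` of a log-concave distribution function whose mean is
at most `1 / (n + 1)` and which satisfies the cone conditions of an `n`-dimensional convex body. -/
theorem one_div_two_exp_le_of_mean_le {n : ℕ} (hn : 2 ≤ n) {F : ℝ → ℝ} (hmono : Monotone F)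
    (h0 : 0 < F 0) (hF0 : ∀ t, 0 ≤ F t) (hF1 : ∀ t, F t ≤ 1)
    (hlog : ∀ s t a b : ℝ, 0 < a → 0 < b → a + b = 1 → F s ^ a * F t ^ b ≤ F (a * s + b * t))
    (hleft : ∀ s ∈ Ioo (0 : ℝ) 1, (1 - s) ^ n * F 0 ≤ F (-s))
    (hright : ∀ r t : ℝ, 0 ≤ r → r ≤ t → t < 1 →
      (1 - F r) * (1 - t) ^ n ≤ (1 - F t) * (1 - r) ^ n)
    (hmean : ∫ t in (-2 : ℝ)..1, (1 - F t) ≤ 2 + 1 / (n + 1)) :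
    1 / (2 * Real.exp 1) ≤ F 0 := by
  obtain ⟨κ, hκ0, hκn, hκ⟩ := exists_exp_support hmono h0 hF0 hlog hleft
  by_contra! hp
  set p := F 0 with hpdef
  have hn' : (2 : ℝ) ≤ n := by exact_mod_cast hn
  have he : 0 < Real.exp 1 := Real.exp_pos 1
  have hpe : p * Real.exp 1 < 1 / 2 := by
    rw [lt_div_iff₀ (by positivity)] at hp
    linarith
  have hanti : Antitone fun t => 1 - F t := fun s t hst => by
    have := hmono hst
    simp only
    linarith
  have hInt : ∀ a b, IntervalIntegrable (fun t => 1 - F t) volume a b := fun a b =>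
    hanti.intervalIntegrable
  have hexp : ∀ a b, IntervalIntegrable (fun t => 1 - p * Real.exp (κ * t)) volume a b := fun a b =>
    Continuous.intervalIntegrable (by fun_prop) a b
  have hexp' : ∀ c a b, IntervalIntegrable (fun t => p * Real.exp (c * t)) volume a b :=
    fun c a b => Continuous.intervalIntegrable (by fun_prop) a b
  rcases lt_or_ge 1 κ with h1 | h1
  · set r := 1 / κ with hr
    have hκpos : 0 < κ := by linarith
    have hr0 : 0 < r := by positivity
    have hr1 : r < 1 := (div_lt_one hκpos).2 h1
    have hκr : κ * r = 1 := by rw [hr]; field_simp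
    have hFr : F r ≤ p * Real.exp 1 := by simpa [hκr] using hκ r
    have i1 : ∫ t in (-2 : ℝ)..r, (1 - p * Real.exp (κ * t)) ≤ ∫ t in (-2 : ℝ)..r, (1 - F t) :=
      intervalIntegral.integral_mono_on (by linarith) (hexp _ _) (hInt _ _) fun t _ => by
        linarith [hκ t]
    have i2 : ∫ t in r..1, (1 - F r) / (1 - r) ^ n * (1 - t) ^ n ≤ ∫ t in r..1, (1 - F t) := by
      refine intervalIntegral.integral_mono_on hr1.le
        (Continuous.intervalIntegrable (by fun_prop) _ _) (hInt _ _) fun t ht => ?_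
      have hpow : 0 < (1 - r) ^ n := pow_pos (by linarith) n
      rw [div_mul_eq_mul_div, div_le_iff₀ hpow]
      rcases ht.2.eq_or_lt with h | h
      · rw [h, sub_self, zero_pow (by omega), mul_zero]
        exact mul_nonneg (by linarith [hF1 1]) hpow.le
      · exact hright r t hr0.le ht.1 h
    have e1 : ∫ t in (-2 : ℝ)..r, (1 - p * Real.exp (κ * t)) =
        r + 2 - p * ((Real.exp 1 - Real.exp (κ * (-2))) / κ) := by
      rw [intervalIntegral.integral_sub (by simp) (hexp' _ _ _),
        intervalIntegral.integral_const_mul, integral_exp_mul hκpos.ne', hκr]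
      simp
    have e2 : ∫ t in r..1, (1 - F r) / (1 - r) ^ n * (1 - t) ^ n =
        (1 - F r) * (1 - r) / (n + 1) := by
      rw [intervalIntegral.integral_const_mul,
        intervalIntegral.integral_comp_sub_left (fun x => x ^ n), integral_pow]
      have : (1 - r) ≠ 0 := by linarith
      simp only [sub_self]
      rw [zero_pow (by omega), pow_succ]
      field_simp
      ring
    have split := intervalIntegral.integral_add_adjacent_intervals (hInt (-2) r) (hInt r 1)
    have b1 : p * ((Real.exp 1 - Real.exp (κ * (-2))) / κ) ≤ p * Real.exp 1 * r := by
      rw [hr, mul_assoc]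
      refine mul_le_mul_of_nonneg_left ?_ h0.le
      rw [mul_one_div]
      gcongr
      linarith [Real.exp_pos (κ * (-2))]
    have b2 : p * Real.exp 1 * r < 1 / 2 * r := mul_lt_mul_of_pos_right hpe hr0
    have b3 : 1 / 2 * (1 - r) / (n + 1) ≤ (1 - F r) * (1 - r) / (n + 1) := by
      gcongr
      linarith
    have b4 : 1 / (n : ℝ) ≤ r := by
      rw [hr]
      exact one_div_le_one_div_of_le hκpos hκn
    have b5 : 1 / ((n : ℝ) + 1) ≤ 1 / 2 * r + 1 / 2 * (1 - r) / (n + 1) := by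
      rw [div_le_iff₀ (by linarith)] at b4
      rw [div_le_iff₀ (by linarith), add_mul, div_mul_cancel₀ _ (by linarith)]
      nlinarith
    linarith
  · have hk : ∀ t, p * Real.exp (κ * t) ≤ p * (1 - κ) + κ * (p * Real.exp (1 * t)) := by
      intro t
      have := convexOn_exp.2 (mem_univ 0) (mem_univ t) (sub_nonneg.2 h1) hκ0 (by ring)
      simp only [smul_eq_mul, mul_zero, zero_add, Real.exp_zero, mul_one] at this
      have := mul_le_mul_of_nonneg_left this h0.le
      rw [one_mul]
      linarith
    have i1 : ∫ t in (-2 : ℝ)..1, (1 - (p * (1 - κ) + κ * (p * Real.exp (1 * t)))) ≤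
        ∫ t in (-2 : ℝ)..1, (1 - F t) :=
      intervalIntegral.integral_mono_on (by norm_num)
        (Continuous.intervalIntegrable (by fun_prop) _ _) (hInt _ _) fun t _ => by
        linarith [hκ t, hk t]
    have e1 : ∫ t in (-2 : ℝ)..1, (1 - (p * (1 - κ) + κ * (p * Real.exp (1 * t)))) =
        3 - (3 * (p * (1 - κ)) + κ * (p * (Real.exp 1 - Real.exp (-2)))) := by
      rw [intervalIntegral.integral_sub (by simp)
        (Continuous.intervalIntegrable (by fun_prop) _ _),
        intervalIntegral.integral_add (by simp) (Continuous.intervalIntegrable (by fun_prop) _ _),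
        intervalIntegral.integral_const_mul, intervalIntegral.integral_const_mul,
        intervalIntegral.integral_const_mul, integral_exp_mul one_ne_zero]
      simp only [intervalIntegral.integral_const, smul_eq_mul]
      norm_num
      ring
    have he2 : 2.7 < Real.exp 1 := lt_trans (by norm_num) Real.exp_one_gt_d9
    have he3 : Real.exp 1 < 2.72 := lt_trans Real.exp_one_lt_d9 (by norm_num)
    have hp3 : p * 2.7 < 1 / 2 := by nlinarith
    have b1 : 1 / ((n : ℝ) + 1) ≤ 1 / 3 := by
      apply one_div_le_one_div_of_le <;> linarith
    have b2 : κ * (p * (Real.exp 1 - Real.exp (-2))) ≤ κ * (p * 3) := by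
      have := Real.exp_pos (-2)
      gcongr
      linarith
    have b3 : 3 * (p * (1 - κ)) + κ * (p * 3) = 3 * p := by ring
    linarith

theorem pow_mul_measureReal_le_of_homothety {n : ℕ} {A B : Set (EuclideanSpace ℝ (Fin n))}
    (hB : volume B ≠ ⊤) {c : ℝ} (hc : 0 ≤ c) (p : EuclideanSpace ℝ (Fin n))
    (h : ∀ x ∈ A, (1 - c) • p + c • x ∈ B) :
    c ^ n * volume.real A ≤ volume.real B := by
  have h1 := Measure.addHaar_image_homothety volume p c A
  rw [finrank_euclideanSpace_fin, abs_of_nonneg (pow_nonneg hc n)] at h1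
  have h2 : AffineMap.homothety p c '' A ⊆ B := by
    rintro _ ⟨x, hx, rfl⟩
    have := h x hx
    rw [AffineMap.homothety_apply]
    convert this using 1
    simp only [vsub_eq_sub, vadd_eq_add]
    module
  have h3 := measureReal_mono h2 hB
  rwa [measureReal_def, h1, ENNReal.toReal_mul, ENNReal.toReal_ofReal (pow_nonneg hc n),
    ← measureReal_def] at h3

/-- If a linear functional takes both the values `-1` and `1` (or beyond) on a convex body and its
mean is at most `1 / (n + 1)`, then it is nonpositive on a proportion of at least `1 / (2e)`. -/
theorem volume_halfspace_ge {n : ℕ} (hn : 2 ≤ n) {K : Set (EuclideanSpace ℝ (Fin n))}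
    (hK : Convex ℝ K) (hKm : MeasurableSet K) (hfin : volume K ≠ ⊤)
    (u : EuclideanSpace ℝ (Fin n) →L[ℝ] ℝ) (hu : ∀ x ∈ K, |u x| ≤ 2)
    {p q : EuclideanSpace ℝ (Fin n)} (hp : p ∈ K) (hq : q ∈ K) (hup : u p ≤ -1) (huq : 1 ≤ u q)
    (hpos : 0 < volume.real (K ∩ {x | u x ≤ 0}))
    (hmean : ∫ x in K, u x ≤ volume.real K / (n + 1)) :
    volume.real K / (2 * Real.exp 1) ≤ volume.real (K ∩ {x | u x ≤ 0}) := by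
  have hum : Measurable u := u.continuous.measurable
  have hfin' : ∀ S : Set (EuclideanSpace ℝ (Fin n)), volume (K ∩ S) ≠ ⊤ := fun S =>
    measure_ne_top_of_subset inter_subset_left hfin
  have hle : ∀ t, MeasurableSet {x | u x ≤ t} := fun t => measurableSet_le hum measurable_const
  set V := volume.real K with hV
  have hVpos : 0 < V := hpos.trans_le (measureReal_mono inter_subset_left hfin)
  have hcompl : ∀ t, 1 - volume.real (K ∩ {x | u x ≤ t}) / V =
      volume.real (K ∩ {x | t < u x}) / V := by
    intro t
    have h1 := measureReal_inter_add_sdiff (μ := volume) (s := K) (hle t) hfin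
    have h2 : K \ {x | u x ≤ t} = K ∩ {x | t < u x} := by
      ext x
      simp
    rw [h2] at h1
    rw [eq_div_iff hVpos.ne', sub_mul, div_mul_cancel₀ _ hVpos.ne']
    linarith
  have key := one_div_two_exp_le_of_mean_le hn (F := fun t => volume.real (K ∩ {x | u x ≤ t}) / V)
    ?_ (div_pos hpos hVpos) (fun t => by positivity) ?_ ?_ ?_ ?_ ?_
  · rw [le_div_iff₀ hVpos] at key
    rw [div_eq_mul_one_div, mul_comm]
    exact key
  · intro s t hst
    refine div_le_div_of_nonneg_right (measureReal_mono ?_ (hfin' _)) hVpos.le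
    exact inter_subset_inter_right _ fun x hx => le_trans hx hst
  · intro t
    rw [div_le_one hVpos]
    exact measureReal_mono inter_subset_left hfin
  · intro s t a b ha hb hab
    have h1 := volume_rpow_mul_le (hKm.inter (hle s)) (hKm.inter (hle t))
      (hKm.inter (hle (a * s + b * t))) ha hb hab (by
        rintro x ⟨hx, hxs⟩ y ⟨hy, hyt⟩
        refine ⟨hK hx hy ha.le hb.le hab, ?_⟩
        simp only [mem_ofPred_eq, map_add, map_smul, smul_eq_mul] at hxs hyt ⊢
        gcongr)
    have h2 := ENNReal.toReal_mono (hfin' _) h1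
    rw [ENNReal.toReal_mul, ← ENNReal.toReal_rpow, ← ENNReal.toReal_rpow, ← measureReal_def,
      ← measureReal_def, ← measureReal_def] at h2
    rw [Real.div_rpow (by positivity) hVpos.le, Real.div_rpow (by positivity) hVpos.le,
      div_mul_div_comm, ← Real.rpow_add hVpos, hab, Real.rpow_one]
    gcongr
  · intro s hs
    rw [← mul_div_assoc]
    refine div_le_div_of_nonneg_right ?_ hVpos.le
    refine pow_mul_measureReal_le_of_homothety (hfin' _) (by linarith [hs.2]) p ?_
    rintro x ⟨hx, hx0⟩
    refine ⟨hK hp hx (by linarith [hs.1]) (by linarith [hs.2]) (by ring), ?_⟩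
    simp only [mem_ofPred_eq, map_add, map_smul, smul_eq_mul] at hx0 ⊢
    nlinarith [hs.1, hs.2]
  · intro r t hr hrt ht
    rw [hcompl, hcompl, div_mul_eq_mul_div, div_mul_eq_mul_div]
    refine div_le_div_of_nonneg_right ?_ hVpos.le
    have hr1 : 0 < 1 - r := by linarith
    have hc : 0 < (1 - t) / (1 - r) := div_pos (by linarith) hr1
    have hc1 : (1 - t) / (1 - r) ≤ 1 := (div_le_one hr1).2 (by linarith)
    have hce : (1 - t) / (1 - r) * (1 - r) = 1 - t := div_mul_cancel₀ _ hr1.ne'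
    have := pow_mul_measureReal_le_of_homothety (A := K ∩ {x | r < u x})
      (B := K ∩ {x | t < u x}) (hfin' _) hc.le q (by
        rintro x ⟨hx, hxr⟩
        refine ⟨hK hq hx (by linarith) hc.le (by ring), ?_⟩
        simp only [mem_ofPred_eq, map_add, map_smul, smul_eq_mul] at hxr ⊢
        nlinarith [mul_lt_mul_of_pos_left hxr hc])
    rw [div_pow, div_mul_eq_mul_div, div_le_iff₀ (by positivity)] at this
    linarith
  · have hui : Integrable (fun x => u x + 2) (volume.restrict K) := by
      refine Measure.integrableOn_of_bounded (M := 4) hfin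
        (hum.add_const 2).aestronglyMeasurable ?_
      refine (ae_restrict_iff' hKm).2 (Filter.Eventually.of_forall fun x hx => ?_)
      have := abs_le.1 (hu x hx)
      rw [Real.norm_eq_abs, abs_le]
      constructor <;> linarith
    have hui' : Integrable (fun x => u x) (volume.restrict K) := by
      refine (hui.sub (integrableOn_const hfin (C := (2 : ℝ)))).congr
        (Filter.Eventually.of_forall fun x => ?_)
      simp
    have hae : ∀ᵐ x ∂(volume.restrict K), |u x| ≤ 2 :=
      (ae_restrict_iff' hKm).2 (Filter.Eventually.of_forall hu)
    have h1 := hui.integral_eq_integral_Ioc_meas_le (M := 4)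
      (hae.mono fun x hx => by simpa using (by linarith [(abs_le.1 hx).1] : 0 ≤ u x + 2))
      (hae.mono fun x hx => by linarith [(abs_le.1 hx).2])
    have h2 : ∫ x in K, (u x + 2) = (∫ x in K, u x) + V * 2 := by
      rw [integral_add hui' (integrableOn_const hfin)]
      simp [hV]
    have hmono : Antitone fun t => (volume.restrict K).real {x | t ≤ u x + 2} := by
      intro s t hst
      exact measureReal_mono (fun x hx => le_trans hst hx)
        (by rw [Measure.restrict_apply (measurableSet_le measurable_const (hum.add_const 2)),
              inter_comm]; exact hfin' _)
    have hanti : Antitone fun t => 1 - volume.real (K ∩ {x | u x ≤ t}) / V := by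
      intro s t hst
      simp only [hcompl]
      refine div_le_div_of_nonneg_right (measureReal_mono ?_ (hfin' _)) hVpos.le
      exact inter_subset_inter_right _ fun x hx => lt_of_le_of_lt hst hx
    rw [← intervalIntegral.integral_of_le (by norm_num)] at h1
    have h3 := intervalIntegral.integral_add_adjacent_intervals
      (hmono.intervalIntegrable (a := 0) (b := 3) (μ := volume))
      (hmono.intervalIntegrable (a := 3) (b := 4) (μ := volume))
    have h4 : 0 ≤ ∫ t in (3 : ℝ)..4, (volume.restrict K).real {x | t ≤ u x + 2} :=
      intervalIntegral.integral_nonneg (by norm_num) fun _ _ => measureReal_nonneg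
    have h5 : ∫ t in (-2 : ℝ)..1, (1 - volume.real (K ∩ {x | u x ≤ t}) / V) =
        ∫ t in (0 : ℝ)..3, (1 - volume.real (K ∩ {x | u x ≤ t - 2}) / V) := by
      rw [intervalIntegral.integral_comp_sub_right
        (fun t => 1 - volume.real (K ∩ {x | u x ≤ t}) / V)]
      norm_num
    have h6 : ∫ t in (0 : ℝ)..3, (1 - volume.real (K ∩ {x | u x ≤ t - 2}) / V) ≤
        ∫ t in (0 : ℝ)..3, (volume.restrict K).real {x | t ≤ u x + 2} / V := by
      refine intervalIntegral.integral_mono_on (by norm_num) ?_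
        (hmono.intervalIntegrable.div_const _) fun t _ => ?_
      · exact Antitone.intervalIntegrable fun s t hst => hanti (sub_le_sub_right hst 2)
      · rw [hcompl, measureReal_restrict_apply
          (measurableSet_le measurable_const (hum.add_const 2)), inter_comm]
        refine div_le_div_of_nonneg_right (measureReal_mono ?_ ?_) hVpos.le
        · rintro x ⟨hx, hxK⟩
          refine ⟨?_, hxK⟩
          simp only [mem_ofPred_eq] at hx ⊢
          linarith
        · rw [inter_comm]
          exact hfin' _
    rw [h5]
    refine h6.trans ?_
    rw [intervalIntegral.integral_div, div_le_iff₀ hVpos]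
    have h7 : V / (n + 1) = 1 / (n + 1) * V := by ring
    rw [h7] at hmean
    linarith

end HalfSpace

section TypeB

open MeasureTheory Set

theorem eB_apply (n : ℕ) (i j : Fin n) : eB n i j = if j = i then 1 else 0 := by
  simp [eB]

theorem inner_eB_left {n : ℕ} (i : Fin n) (x : EuclideanSpace ℝ (Fin n)) : ⟪eB n i, x⟫_ℝ = x i := by
  simp [eB, EuclideanSpace.inner_single_left]

theorem inner_eB_right {n : ℕ} (i : Fin n) (x : EuclideanSpace ℝ (Fin n)) :
    ⟪x, eB n i⟫_ℝ = x i := by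
  rw [real_inner_comm, inner_eB_left]

/-- The linear automorphism `w` permutes the coordinates up to sign. -/
def IsSignedPerm {n : ℕ} (w : EuclideanSpace ℝ (Fin n) ≃ₗ[ℝ] EuclideanSpace ℝ (Fin n)) : Prop :=
  ∃ (σ : Equiv.Perm (Fin n)) (ε : Fin n → ℤˣ), ∀ x i, w x i = ((ε i : ℤ) : ℝ) * x (σ i)

theorem intUnits_cast_mul_self (u : ℤˣ) : ((u : ℤ) : ℝ) * ((u : ℤ) : ℝ) = 1 := by
  rcases Int.units_eq_one_or u with h | h <;> simp [h]

theorem isSignedPerm_of_posB {n : ℕ} {α : EuclideanSpace ℝ (Fin n)} (hα : α ∈ posB n)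
    {g : EuclideanSpace ℝ (Fin n) ≃ₗ[ℝ] EuclideanSpace ℝ (Fin n)}
    (hg : ∀ x, g x = x - (2 * ⟪α, x⟫_ℝ / ⟪α, α⟫_ℝ) • α) : IsSignedPerm g := by
  rcases hα with ⟨i, j, hij, rfl | rfl⟩ | ⟨i, rfl⟩
  · refine ⟨Equiv.swap i j, 1, fun x k => ?_⟩
    rw [hg]
    simp only [inner_sub_left, inner_eB_left, PiLp.sub_apply, PiLp.smul_apply, eB_apply,
      smul_eq_mul, Equiv.swap_apply_def]
    rcases eq_or_ne k i with rfl | hi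
    · simp [hij.ne, hij.ne']; ring
    · rcases eq_or_ne k j with rfl | hj
      · simp [hij.ne, hij.ne']; ring
      · simp [hij.ne, hij.ne', hi, hj]
  · refine ⟨Equiv.swap i j, fun k => if k = i ∨ k = j then -1 else 1, fun x k => ?_⟩
    rw [hg]
    simp only [inner_add_left, inner_eB_left, PiLp.add_apply, PiLp.sub_apply, PiLp.smul_apply,
      eB_apply, smul_eq_mul, Equiv.swap_apply_def]
    rcases eq_or_ne k i with rfl | hi
    · simp [hij.ne, hij.ne']; ring
    · rcases eq_or_ne k j with rfl | hj
      · simp [hij.ne, hij.ne']; ring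
      · simp [hij.ne, hij.ne', hi, hj]
  · refine ⟨1, fun k => if k = i then -1 else 1, fun x k => ?_⟩
    rw [hg]
    simp only [inner_eB_left, PiLp.sub_apply, PiLp.smul_apply, eB_apply, smul_eq_mul]
    rcases eq_or_ne k i with rfl | hi
    · simp; ring
    · simp [hi]

theorem isSignedPerm_of_mem_weylB {n : ℕ}
    {w : EuclideanSpace ℝ (Fin n) ≃ₗ[ℝ] EuclideanSpace ℝ (Fin n)} (hw : w ∈ weylB n) :
    IsSignedPerm w := by
  induction hw using Subgroup.closure_induction with
  | mem g hg =>
    obtain ⟨α, hα | hα, hg⟩ := hg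
    · exact isSignedPerm_of_posB hα hg
    · exact isSignedPerm_of_posB hα fun x => by simp [hg x, neg_div]
  | one => exact ⟨1, 1, fun x i => by simp⟩
  | mul a b _ _ ha hb =>
    obtain ⟨σ, ε, ha⟩ := ha
    obtain ⟨τ, δ, hb⟩ := hb
    refine ⟨τ * σ, fun i => ε i * δ (σ i), fun x i => ?_⟩
    rw [LinearEquiv.mul_apply, ha, hb]
    simp [mul_assoc]
  | inv a _ ha =>
    obtain ⟨σ, ε, ha⟩ := ha
    refine ⟨σ⁻¹, fun i => ε (σ⁻¹ i), fun x i => ?_⟩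
    have h : x = a (a⁻¹ x) := by
      rw [← LinearEquiv.mul_apply, mul_inv_cancel, LinearEquiv.coe_one, id]
    conv_rhs => rw [h]
    rw [ha, ← mul_assoc, intUnits_cast_mul_self, one_mul]
    simp

section Weyl

variable {n : ℕ} {w : EuclideanSpace ℝ (Fin n) ≃ₗ[ℝ] EuclideanSpace ℝ (Fin n)}

theorem weylB_inner_map_map (hw : w ∈ weylB n) (x y : EuclideanSpace ℝ (Fin n)) :
    ⟪w x, w y⟫_ℝ = ⟪x, y⟫_ℝ := by
  obtain ⟨σ, ε, h⟩ := isSignedPerm_of_mem_weylB hw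
  simp only [PiLp.inner_apply, h]
  rw [← Equiv.sum_comp σ (fun i => ⟪x i, y i⟫_ℝ)]
  refine Finset.sum_congr rfl fun i _ => ?_
  have := intUnits_cast_mul_self (ε i)
  simp only [RCLike.inner_apply, conj_trivial]
  linear_combination (x (σ i) * y (σ i)) * this

theorem weylB_inv_apply_self (x : EuclideanSpace ℝ (Fin n)) : w (w⁻¹ x) = x := by
  rw [← LinearEquiv.mul_apply, mul_inv_cancel, LinearEquiv.coe_one, id]

theorem weylB_inner_inv_left (hw : w ∈ weylB n) (x y : EuclideanSpace ℝ (Fin n)) :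
    ⟪w⁻¹ x, y⟫_ℝ = ⟪x, w y⟫_ℝ := by
  rw [← weylB_inner_map_map hw, weylB_inv_apply_self]

theorem weylB_abs_apply_le (hw : w ∈ weylB n) {x : EuclideanSpace ℝ (Fin n)}
    (hx : ∀ i, |x i| ≤ 1) (i : Fin n) : |w x i| ≤ 1 := by
  obtain ⟨σ, ε, h⟩ := isSignedPerm_of_mem_weylB hw
  rw [h, abs_mul]
  rcases Int.units_eq_one_or (ε i) with h' | h' <;> simpa [h'] using hx (σ i)

theorem smul_eB_add_smul_eB_mem_rootsB {i j : Fin n} (hij : i ≠ j) (s t : ℤˣ) :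
    ((s : ℤ) : ℝ) • eB n i + ((t : ℤ) : ℝ) • eB n j ∈ rootsB n := by
  wlog h : i < j generalizing i j s t
  · rw [add_comm]
    exact this hij.symm t s (lt_of_le_of_ne (not_lt.1 h) hij.symm)
  rcases Int.units_eq_one_or s with rfl | rfl <;> rcases Int.units_eq_one_or t with rfl | rfl
  · exact Or.inl (Or.inl ⟨i, j, h, Or.inr (by simp)⟩)
  · exact Or.inl (Or.inl ⟨i, j, h, Or.inl (by simp [sub_eq_add_neg])⟩)
  · exact Or.inr (Or.inl ⟨i, j, h, Or.inl (by simp; abel)⟩)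
  · exact Or.inr (Or.inl ⟨i, j, h, Or.inr (by simp; abel)⟩)

theorem smul_eB_mem_rootsB (i : Fin n) (s : ℤˣ) : ((s : ℤ) : ℝ) • eB n i ∈ rootsB n := by
  rcases Int.units_eq_one_or s with rfl | rfl
  · exact Or.inl (Or.inr ⟨i, by simp⟩)
  · exact Or.inr (Or.inr ⟨i, by simp⟩)

theorem weylB_map_posB (hw : w ∈ weylB n) {α : EuclideanSpace ℝ (Fin n)} (hα : α ∈ posB n) :
    w α ∈ posB n ∨ -(w α) ∈ posB n := by
  obtain ⟨σ, ε, h⟩ := isSignedPerm_of_mem_weylB hw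
  have he : ∀ i, w (eB n i) = ((ε (σ.symm i) : ℤ) : ℝ) • eB n (σ.symm i) := by
    intro i
    ext j
    rw [h, PiLp.smul_apply, smul_eq_mul, eB_apply, eB_apply]
    rcases eq_or_ne j (σ.symm i) with rfl | hj
    · simp
    · have : σ j ≠ i := fun h => hj (by rw [← h, Equiv.symm_apply_apply])
      simp [hj, this]
  change w α ∈ rootsB n
  rcases hα with ⟨i, j, hij, rfl | rfl⟩ | ⟨i, rfl⟩
  · rw [map_sub, he, he]
    have := smul_eB_add_smul_eB_mem_rootsB (σ.symm.injective.ne hij.ne) (ε (σ.symm i))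
      (-ε (σ.symm j))
    simpa [sub_eq_add_neg] using this
  · rw [map_add, he, he]
    exact smul_eB_add_smul_eB_mem_rootsB (σ.symm.injective.ne hij.ne) _ _
  · rw [he]
    exact smul_eB_mem_rootsB _ _

/-- An element of the Weyl group that maps a point of the open dominant chamber into the open
dominant chamber is the identity. -/
theorem weylB_eq_one_of_dominant (hw : w ∈ weylB n) {x : EuclideanSpace ℝ (Fin n)}
    (hx : ∀ γ ∈ posB n, 0 < ⟪x, γ⟫_ℝ) (hwx : ∀ γ ∈ posB n, 0 < ⟪w x, γ⟫_ℝ) : w = 1 := by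
  obtain ⟨σ, ε, h⟩ := isSignedPerm_of_mem_weylB hw
  have hpos : ∀ {y : EuclideanSpace ℝ (Fin n)}, (∀ γ ∈ posB n, 0 < ⟪y, γ⟫_ℝ) → ∀ i, 0 < y i := by
    intro y hy i
    simpa [inner_eB_right] using hy _ (Or.inr ⟨i, rfl⟩)
  have hanti : ∀ {y : EuclideanSpace ℝ (Fin n)}, (∀ γ ∈ posB n, 0 < ⟪y, γ⟫_ℝ) →
      StrictAnti fun i => y i := by
    intro y hy i j hij
    simpa [inner_eB_right, inner_sub_right] using hy _ (Or.inl ⟨i, j, hij, Or.inl rfl⟩)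
  have hε : ∀ i, ε i = 1 := by
    intro i
    rcases Int.units_eq_one_or (ε i) with h' | h'
    · exact h'
    · have h1 := hpos hwx i
      have h2 := hpos hx (σ i)
      rw [h, h'] at h1
      simp at h1
      linarith
  have hσ : StrictMono σ := by
    intro i j hij
    have h1 := hanti hwx hij
    simp only [h, hε, Units.val_one, Int.cast_one, one_mul] at h1
    exact (hanti hx).lt_iff_gt.1 h1
  have hσ1 : (σ : Fin n → Fin n) = id := hσ.eq_id
  ext y i
  rw [h, hε, hσ1]
  simp

/-- The Weyl vector of the dual root system, `ρ = (n, n - 1, …, 1)`. -/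
noncomputable def rhoB (n : ℕ) : EuclideanSpace ℝ (Fin n) :=
  WithLp.toLp 2 fun i => (n : ℝ) - (i : ℕ)

theorem rhoB_apply (i : Fin n) : rhoB n i = (n : ℝ) - (i : ℕ) := rfl

theorem one_le_inner_rhoB {γ : EuclideanSpace ℝ (Fin n)} (hγ : γ ∈ posB n) :
    1 ≤ ⟪rhoB n, γ⟫_ℝ := by
  have hlt : ∀ i : Fin n, (1 : ℝ) ≤ n - (i : ℕ) := by
    intro i
    have : ((i : ℕ) : ℝ) + 1 ≤ n := by exact_mod_cast i.2
    linarith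
  rcases hγ with ⟨i, j, hij, rfl | rfl⟩ | ⟨i, rfl⟩
  · have : ((i : ℕ) : ℝ) + 1 ≤ (j : ℕ) := by exact_mod_cast hij
    rw [inner_sub_right, inner_eB_right, inner_eB_right, rhoB_apply, rhoB_apply]
    linarith
  · rw [inner_add_right, inner_eB_right, inner_eB_right, rhoB_apply, rhoB_apply]
    linarith [hlt i, hlt j]
  · rw [inner_eB_right, rhoB_apply]
    exact hlt i

theorem exists_mem_weylB_reflection {α : EuclideanSpace ℝ (Fin n)} (hα : α ∈ posB n) :
    ∃ s ∈ weylB n, ∀ x, s x = x - (2 * ⟪α, x⟫_ℝ / ⟪α, α⟫_ℝ) • α := by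
  have hα0 : ⟪α, α⟫_ℝ ≠ 0 := by
    intro h
    have := one_le_inner_rhoB hα
    rw [inner_self_eq_zero.1 h, inner_zero_right] at this
    linarith
  let f : Module.Dual ℝ (EuclideanSpace ℝ (Fin n)) := (2 / ⟪α, α⟫_ℝ) • (innerₗ _ α)
  have hf : f α = 2 := by
    simp only [f, LinearMap.smul_apply, innerₗ_apply_apply, smul_eq_mul]
    field_simp
  have hs : ∀ x, Module.reflection hf x = x - (2 * ⟪α, x⟫_ℝ / ⟪α, α⟫_ℝ) • α := by
    intro x
    rw [Module.reflection_apply]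
    simp only [f, LinearMap.smul_apply, innerₗ_apply_apply, smul_eq_mul]
    rw [div_mul_eq_mul_div]
  exact ⟨_, Subgroup.subset_closure ⟨α, Or.inl hα, hs⟩, hs⟩

/-- Every Weyl group orbit meets the closed dominant chamber. -/
theorem exists_weylB_dominant (x : EuclideanSpace ℝ (Fin n)) :
    ∃ w ∈ weylB n, ∀ γ ∈ posB n, 0 ≤ ⟪w x, γ⟫_ℝ := by
  have hfin : {r : ℝ | ∃ w ∈ weylB n, r = ⟪rhoB n, w x⟫_ℝ}.Finite := by
    refine (Set.finite_range fun p : Equiv.Perm (Fin n) × (Fin n → ℤˣ) =>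
      ∑ i, ((p.2 i : ℤ) : ℝ) * x (p.1 i) * rhoB n i).subset ?_
    rintro r ⟨w, hw, rfl⟩
    obtain ⟨σ, ε, h⟩ := isSignedPerm_of_mem_weylB hw
    exact ⟨(σ, ε), by simp [PiLp.inner_apply, h]⟩
  obtain ⟨r, ⟨w, hw, rfl⟩, hmax⟩ := hfin.exists_maximal ⟨_, 1, (weylB n).one_mem, rfl⟩
  refine ⟨w, hw, fun γ hγ => ?_⟩
  obtain ⟨s, hs, hsx⟩ := exists_mem_weylB_reflection hγ
  by_contra! hneg
  have h1 := one_le_inner_rhoB hγ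
  have hγ0 : 0 < ⟪γ, γ⟫_ℝ := by
    refine real_inner_self_pos.2 fun h => ?_
    rw [h, inner_zero_right] at h1
    linarith
  have h2 : ⟪rhoB n, w x⟫_ℝ < ⟪rhoB n, (s * w) x⟫_ℝ := by
    rw [LinearEquiv.mul_apply, hsx, inner_sub_right, inner_smul_right, real_inner_comm]
    have : 2 * ⟪γ, w x⟫_ℝ / ⟪γ, γ⟫_ℝ < 0 := by
      rw [real_inner_comm γ] at hneg
      exact div_neg_of_neg_of_pos (by linarith) hγ0
    have := mul_neg_of_neg_of_pos this (zero_lt_one.trans_le h1)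
    rw [real_inner_comm (rhoB n)]
    linarith
  exact absurd (hmax ⟨s * w, mul_mem hs hw, rfl⟩ h2.le) (not_le.2 h2)

end Weyl

section Selection

variable {n : ℕ}

/-- A vector pairing at least `m` with every positive root dominates `m` times the Weyl vector. -/
theorem mul_rhoB_le_of_forall_le_inner {m : ℝ} {x : EuclideanSpace ℝ (Fin n)}
    (h : ∀ γ ∈ posB n, m ≤ ⟪x, γ⟫_ℝ) (i : Fin n) : m * rhoB n i ≤ x i := by
  have key : ∀ k : ℕ, ∀ i : Fin n, (i : ℕ) + (k + 1) = n → m * rhoB n i ≤ x i := by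
    intro k
    induction k with
    | zero =>
      intro i hi
      have h1 := h _ (Or.inr ⟨i, rfl⟩)
      rw [inner_eB_right] at h1
      have : (n : ℝ) = (i : ℕ) + 1 := by exact_mod_cast hi.symm
      rw [rhoB_apply, this]
      linarith
    | succ k ih =>
      intro i hi
      have hlt : (i : ℕ) + 1 < n := by omega
      have h1 := h _ (Or.inl ⟨i, ⟨i + 1, hlt⟩, Fin.lt_def.2 (Nat.lt_succ_self _), Or.inl rfl⟩)
      have h2 := ih ⟨i + 1, hlt⟩ (by simp only; omega)
      rw [inner_sub_right, inner_eB_right, inner_eB_right] at h1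
      rw [rhoB_apply] at h2 ⊢
      push_cast at h2
      linarith
  exact key (n - 1 - i) i (by omega)

theorem exists_abs_sum_inner_lt_card
    (C : Finset (EuclideanSpace ℝ (Fin n) ≃ₗ[ℝ] EuclideanSpace ℝ (Fin n)))
    (hC : ∀ w ∈ C, w ∈ weylB n) (hcard : 1 < C.card) :
    ∃ β ∈ posB n, |∑ w ∈ C, ⟪rhoB n, w β⟫_ℝ| < C.card := by
  by_contra! hcon
  obtain ⟨g, hg, hdom⟩ := exists_weylB_dominant (∑ w ∈ C, w⁻¹ (rhoB n))
  have hv : ∀ y, ⟪∑ w ∈ C, w⁻¹ (rhoB n), y⟫_ℝ = ∑ w ∈ C, ⟪rhoB n, w y⟫_ℝ := by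
    intro y
    rw [sum_inner]
    exact Finset.sum_congr rfl fun w hw => weylB_inner_inv_left (hC w hw) _ _
  set v := ∑ w ∈ C, w⁻¹ (rhoB n) with hvdef
  have hge : ∀ γ ∈ posB n, (C.card : ℝ) ≤ ⟪g v, γ⟫_ℝ := by
    intro γ hγ
    have h1 : ⟪g v, γ⟫_ℝ = ⟪v, g⁻¹ γ⟫_ℝ := by
      rw [← weylB_inner_map_map hg v, weylB_inv_apply_self]
    rw [← abs_of_nonneg (hdom γ hγ), h1]
    rcases weylB_map_posB (inv_mem hg) hγ with h | h
    · rw [hv]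
      exact hcon _ h
    · rw [← abs_neg, ← inner_neg_right, hv]
      exact hcon _ h
  have hlow : (C.card : ℝ) * ⟪rhoB n, rhoB n⟫_ℝ ≤ ⟪rhoB n, g v⟫_ℝ := by
    simp only [PiLp.inner_apply, RCLike.inner_apply, conj_trivial]
    rw [Finset.mul_sum]
    refine Finset.sum_le_sum fun i _ => ?_
    have h0 : 0 ≤ rhoB n i := by
      rw [rhoB_apply, sub_nonneg]
      exact Nat.cast_le.2 i.2.le
    have := mul_le_mul_of_nonneg_right (mul_rhoB_le_of_forall_le_inner hge i) h0
    linarith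
  have hnorm : ∀ w ∈ C, ⟪g (w⁻¹ (rhoB n)), g (w⁻¹ (rhoB n))⟫_ℝ = ⟪rhoB n, rhoB n⟫_ℝ := by
    intro w hw
    rw [weylB_inner_map_map hg, weylB_inner_map_map (inv_mem (hC w hw))]
  have hdist : ∀ w ∈ C, ⟪rhoB n - g (w⁻¹ (rhoB n)), rhoB n - g (w⁻¹ (rhoB n))⟫_ℝ =
      2 * (⟪rhoB n, rhoB n⟫_ℝ - ⟪rhoB n, g (w⁻¹ (rhoB n))⟫_ℝ) := by
    intro w hw
    rw [real_inner_sub_sub_self, hnorm w hw]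
    ring
  have hsum : ∑ w ∈ C, (⟪rhoB n, rhoB n⟫_ℝ - ⟪rhoB n, g (w⁻¹ (rhoB n))⟫_ℝ) ≤ 0 := by
    rw [Finset.sum_sub_distrib, Finset.sum_const, nsmul_eq_mul, ← inner_sum, ← map_sum, ← hvdef]
    linarith
  have hnn : ∀ w ∈ C, 0 ≤ ⟪rhoB n, rhoB n⟫_ℝ - ⟪rhoB n, g (w⁻¹ (rhoB n))⟫_ℝ := by
    intro w hw
    have := real_inner_self_nonneg (x := rhoB n - g (w⁻¹ (rhoB n)))
    rw [hdist w hw] at this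
    linarith
  have heq : ∀ w ∈ C, w = g := by
    intro w hw
    have h0 := (Finset.sum_eq_zero_iff_of_nonneg hnn).1
      (le_antisymm hsum (Finset.sum_nonneg hnn)) w hw
    have h1 : rhoB n - g (w⁻¹ (rhoB n)) = 0 := by
      rw [← inner_self_eq_zero (𝕜 := ℝ), hdist w hw, h0, mul_zero]
    have hpos : ∀ γ ∈ posB n, 0 < ⟪rhoB n, γ⟫_ℝ := fun γ hγ =>
      zero_lt_one.trans_le (one_le_inner_rhoB hγ)
    have h2 : g * w⁻¹ = 1 := by
      refine weylB_eq_one_of_dominant (mul_mem hg (inv_mem (hC w hw))) hpos ?_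
      rw [LinearEquiv.mul_apply, ← sub_eq_zero.1 h1]
      exact hpos
    exact (mul_inv_eq_one.1 h2).symm
  obtain ⟨a, ha, b, hb, hab⟩ := Finset.one_lt_card.1 hcard
  exact hab ((heq a ha).trans (heq b hb).symm)

end Selection

section Alcove

variable {n : ℕ}

/-- The coordinates of `x`, preceded by the entry `c` and followed by zeros. -/
def padCoord (c : ℝ) (x : EuclideanSpace ℝ (Fin n)) : ℕ → ℝ
  | 0 => c
  | k + 1 => if h : k < n then x ⟨k, h⟩ else 0

theorem padCoord_add (c d : ℝ) (x y : EuclideanSpace ℝ (Fin n)) (j : ℕ) :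
    padCoord (c + d) (x + y) j = padCoord c x j + padCoord d y j := by
  cases j with
  | zero => rfl
  | succ k => by_cases h : k < n <;> simp [padCoord, h]

theorem padCoord_smul (r c : ℝ) (x : EuclideanSpace ℝ (Fin n)) (j : ℕ) :
    padCoord (r * c) (r • x) j = r * padCoord c x j := by
  cases j with
  | zero => rfl
  | succ k => by_cases h : k < n <;> simp [padCoord, h]

theorem padCoord_succ (c : ℝ) (x : EuclideanSpace ℝ (Fin n)) (i : Fin n) :
    padCoord c x (i + 1) = x i := by
  simp [padCoord]

theorem padCoord_add_smul_eB (c r : ℝ) (x : EuclideanSpace ℝ (Fin n)) (i : Fin n) (j : ℕ) :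
    padCoord c (x + r • eB n i) j = padCoord c x j + if j = i + 1 then r else 0 := by
  cases j with
  | zero => simp [padCoord]
  | succ k =>
    by_cases h : k < n
    · have : (⟨k, h⟩ : Fin n) = i ↔ k = i := Fin.ext_iff
      simp [padCoord, h, eB_apply, this]
    · have : k ≠ i := by omega
      simp [padCoord, h, this]

theorem continuous_padCoord (c : ℝ) (j : ℕ) :
    Continuous fun x : EuclideanSpace ℝ (Fin n) => padCoord c x j := by
  cases j with
  | zero => exact continuous_const
  | succ k =>
    by_cases h : k < n
    · simp only [padCoord, h, dite_true]
      fun_prop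
    · simp only [padCoord, h, dite_false]
      fun_prop

/-- The simplex `1 ≥ x₁ ≥ ⋯ ≥ xₙ ≥ 0`. -/
def orderSimplex (n : ℕ) : Set (EuclideanSpace ℝ (Fin n)) :=
  {x | ∀ j ≤ n, padCoord 1 x (j + 1) ≤ padCoord 1 x j}

/-- The symmetry of the simplex `1 ≥ x₁ ≥ ⋯ ≥ xₙ ≥ 0` that exchanges two consecutive gaps. -/
theorem exists_measurePreserving_gap_swap (i : Fin n) :
    ∃ T : EuclideanSpace ℝ (Fin n) → EuclideanSpace ℝ (Fin n),
      MeasurePreserving T ∧ MeasurableEmbedding T ∧ T ⁻¹' orderSimplex n = orderSimplex n ∧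
        ∀ x, T x i = padCoord 1 x i + padCoord 1 x (i + 2) - x i := by
  let f : Module.Dual ℝ (EuclideanSpace ℝ (Fin n)) :=
    { toFun := fun x => 2 * x i - padCoord 0 x i - padCoord 0 x (i + 2)
      map_add' := fun x y => by
        have h1 := padCoord_add 0 0 x y i
        have h2 := padCoord_add 0 0 x y (i + 2)
        rw [add_zero] at h1 h2
        rw [h1, h2, PiLp.add_apply]
        ring
      map_smul' := fun r x => by
        have h1 := padCoord_smul r 0 x i
        have h2 := padCoord_smul r 0 x (i + 2)
        rw [mul_zero] at h1 h2
        rw [h1, h2, PiLp.smul_apply]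
        simp only [smul_eq_mul, RingHom.id_apply]
        ring }
  have hf : ∀ x, f x = 2 * x i - padCoord 0 x i - padCoord 0 x (i + 2) := fun x => rfl
  have hf2 : f (eB n i) = 2 := by
    have h (j : ℕ) := padCoord_add_smul_eB 0 1 0 i j
    have h0 (j : ℕ) : padCoord 0 (0 : EuclideanSpace ℝ (Fin n)) j = 0 := by
      have := padCoord_smul 0 0 (0 : EuclideanSpace ℝ (Fin n)) j
      simpa using this
    simp only [zero_add, one_smul, h0] at h
    rw [hf, h, h, eB_apply]
    simp
  let r := Module.reflection hf2
  let c : EuclideanSpace ℝ (Fin n) := padCoord 1 (0 : EuclideanSpace ℝ (Fin n)) i • eB n i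
  have hpad (x : EuclideanSpace ℝ (Fin n)) (j : ℕ) :
      padCoord 1 x j = padCoord 0 x j + padCoord 1 (0 : EuclideanSpace ℝ (Fin n)) j := by
    simpa using padCoord_add 0 1 x 0 j
  have hT (x : EuclideanSpace ℝ (Fin n)) :
      r x + c = x + (padCoord 1 x i + padCoord 1 x (i + 2) - 2 * x i) • eB n i := by
    have h2 : padCoord 1 (0 : EuclideanSpace ℝ (Fin n)) (i + 2) = 0 := by simp [padCoord]
    rw [Module.reflection_apply, hf, hpad x i, hpad x (i + 2), h2]
    module
  have hdet :
      |(LinearMap.det (r : EuclideanSpace ℝ (Fin n) →ₗ[ℝ] EuclideanSpace ℝ (Fin n)))| = 1 := by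
    have hcomp : (r : EuclideanSpace ℝ (Fin n) →ₗ[ℝ] EuclideanSpace ℝ (Fin n)) ∘ₗ
        (r : EuclideanSpace ℝ (Fin n) →ₗ[ℝ] EuclideanSpace ℝ (Fin n)) = LinearMap.id :=
      LinearMap.ext fun x => Module.involutive_reflection hf2 x
    have := congrArg LinearMap.det hcomp
    rw [LinearMap.det_comp, LinearMap.det_id] at this
    rw [abs_eq zero_le_one]
    exact mul_self_eq_one_iff.1 this
  have hrcont : Continuous r := LinearMap.continuous_of_finiteDimensional r.toLinearMap
  have hr : MeasurePreserving r := by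
    refine ⟨hrcont.measurable, ?_⟩
    have := Measure.map_linearMap_addHaar_eq_smul_addHaar
      (volume : Measure (EuclideanSpace ℝ (Fin n))) (f := r.toLinearMap)
      (fun h => by rw [h] at hdet; simp at hdet)
    rw [abs_inv, hdet] at this
    simpa using this
  refine ⟨fun x => r x + c, (measurePreserving_add_right volume c).comp hr, ?_, ?_, ?_⟩
  · exact (measurableEmbedding_addRight c).comp
      (hrcont.measurableEmbedding r.injective)
  · ext x
    have hp (j : ℕ) : padCoord 1 (r x + c) j =
        if j = i + 1 then padCoord 1 x i + padCoord 1 x (i + 2) - padCoord 1 x (i + 1)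
        else padCoord 1 x j := by
      rw [hT, padCoord_add_smul_eB]
      split_ifs with h
      · rw [h, padCoord_succ]
        ring
      · rw [add_zero]
    have hi := i.2
    simp only [orderSimplex, mem_preimage, mem_ofPred_eq, hp]
    constructor
    · intro h j hj
      have h1 := h i hi.le
      have h2 := h (i + 1) hi
      simp at h1 h2
      rcases eq_or_ne j i with rfl | hji
      · linarith
      · rcases eq_or_ne j (i + 1) with rfl | hji'
        · linarith
        · simpa [hji, hji'] using h j hj
    · intro h j hj
      have h1 := h i hi.le
      have h2 := h (i + 1) hi
      rcases eq_or_ne j i with rfl | hji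
      · simpa using h2
      · rcases eq_or_ne j (i + 1) with rfl | hji'
        · rw [if_neg (by omega), if_pos rfl]
          linarith
        · simpa [hji, hji'] using h j hj
  · intro x
    simp only [hT, PiLp.add_apply, PiLp.smul_apply, eB_apply, smul_eq_mul]
    simp
    ring

/-- The cube `[-1, 1]ⁿ`. -/
def unitCube (n : ℕ) : Set (EuclideanSpace ℝ (Fin n)) := {x | ∀ i, |x i| ≤ 1}

theorem isCompact_unitCube : IsCompact (unitCube n) := by
  have h : unitCube n = (PiLp.homeomorph 2 fun _ : Fin n => ℝ) ⁻¹'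
      (Set.univ.pi fun _ => Set.Icc (-1) 1) := by
    ext x
    simp only [unitCube, mem_ofPred_eq, abs_le, mem_preimage, mem_univ_pi, mem_Icc]
    rfl
  rw [h, Homeomorph.isCompact_preimage]
  exact isCompact_univ_pi fun _ => isCompact_Icc

theorem padCoord_mem_Icc {x : EuclideanSpace ℝ (Fin n)} (hx : x ∈ orderSimplex n) {j : ℕ}
    (hj : j ≤ n + 1) : padCoord 1 x j ∈ Icc 0 1 := by
  constructor
  · have key : ∀ k j : ℕ, j + k = n + 1 → 0 ≤ padCoord 1 x j := by
      intro k
      induction k with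
      | zero =>
        rintro j rfl
        simp [padCoord]
      | succ k ih =>
        intro j hj
        exact (ih (j + 1) (by omega)).trans (hx j (by omega))
    exact key (n + 1 - j) j (by omega)
  · induction j with
    | zero => exact le_rfl
    | succ k ih => exact (hx k (by omega)).trans (ih (by omega))

theorem orderSimplex_subset_unitCube : orderSimplex n ⊆ unitCube n := by
  intro x hx i
  have h := padCoord_mem_Icc hx (j := i + 1) (by omega)
  rw [padCoord_succ] at h
  rw [abs_of_nonneg h.1]
  exact h.2

theorem integral_orderSimplex_apply (i : Fin n) :
    ∫ x in orderSimplex n, x i =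
      volume.real (orderSimplex n) / (n + 1) * rhoB n i := by
  have hInt (j : ℕ) : IntegrableOn (fun x => padCoord 1 x j) (orderSimplex n) :=
    ((continuous_padCoord 1 j).continuousOn.integrableOn_compact isCompact_unitCube).mono_set
      orderSimplex_subset_unitCube
  have hrec (k : ℕ) (hk : k < n) : 2 * ∫ x in orderSimplex n, padCoord 1 x (k + 1) =
      (∫ x in orderSimplex n, padCoord 1 x k) + ∫ x in orderSimplex n, padCoord 1 x (k + 2) := by
    obtain ⟨T, hT, hTe, hTs, hTi⟩ := exists_measurePreserving_gap_swap (⟨k, hk⟩ : Fin n)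
    have h1 := hT.setIntegral_preimage_emb hTe (fun x => padCoord 1 x (k + 1)) (orderSimplex n)
    have h2 (x : EuclideanSpace ℝ (Fin n)) : padCoord 1 (T x) (k + 1) =
        padCoord 1 x k + padCoord 1 x (k + 2) - padCoord 1 x (k + 1) := by
      have h3 (y : EuclideanSpace ℝ (Fin n)) : padCoord 1 y (k + 1) = y ⟨k, hk⟩ :=
        padCoord_succ 1 y ⟨k, hk⟩
      rw [h3, hTi, h3]
    simp only [hTs, h2] at h1
    rw [integral_sub (f := fun x => padCoord 1 x k + padCoord 1 x (k + 2))
      ((hInt _).add (hInt _)) (hInt _), integral_add (hInt _) (hInt _)] at h1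
    linarith
  have hlin (k : ℕ) (hk : k ≤ n) : ∫ x in orderSimplex n, padCoord 1 x (k + 1) =
      (k + 1) * (∫ x in orderSimplex n, padCoord 1 x 1) -
        k * ∫ x in orderSimplex n, padCoord 1 x 0 := by
    induction k using Nat.strong_induction_on with
    | _ k ih =>
      rcases k with _ | _ | k
      · simp
      · have := hrec 0 (by omega)
        push_cast
        simp only [zero_add] at this ⊢
        linarith
      · have h1 := hrec (k + 1) (by omega)
        have h2 := ih (k + 1) (by omega) (by omega)
        have h3 := ih k (by omega) (by omega)
        push_cast at h2 ⊢
        have e : k + 1 + 1 = k + 2 := rfl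
        rw [e] at h1 h2
        have e : k + 1 + 2 = k + 2 + 1 := rfl
        rw [e] at h1
        rw [show k + 1 + 1 + 1 = k + 2 + 1 from rfl]
        linear_combination -h1 + 2 * h2 - h3
  have h0 : ∫ x in orderSimplex n, padCoord 1 x 0 = volume.real (orderSimplex n) := by
    simp [padCoord]
  have hlast : ∫ x in orderSimplex n, padCoord 1 x (n + 1) = 0 := by
    simp [padCoord]
  rw [hlin n le_rfl, h0] at hlast
  have hi := hlin i i.2.le
  simp only [padCoord_succ, h0] at hi
  rw [hi, rhoB_apply]
  have hn : (n : ℝ) + 1 ≠ 0 := by positivity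
  field_simp
  linear_combination ((i : ℕ) + 1 : ℝ) * hlast

end Alcove

section Cells

variable {n : ℕ}

/-- The part of the cube `[-1, 1]ⁿ` inside the open dominant chamber. -/
def dominantAlcove (n : ℕ) : Set (EuclideanSpace ℝ (Fin n)) :=
  {x | ∀ γ ∈ posB n, 0 < ⟪x, γ⟫_ℝ} ∩ unitCube n

theorem finite_posB : (posB n).Finite := by
  refine (finite_range fun p : Fin n × Fin n × Bool × Bool =>
    if p.2.2.1 then eB n p.1 else if p.2.2.2 then eB n p.1 - eB n p.2.1
      else eB n p.1 + eB n p.2.1).subset ?_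
  rintro _ (⟨i, j, -, rfl | rfl⟩ | ⟨i, rfl⟩)
  · exact ⟨(i, j, false, true), by simp⟩
  · exact ⟨(i, j, false, false), by simp⟩
  · exact ⟨(i, i, true, true), by simp⟩

theorem ae_inner_posB_ne_zero :
    ∀ᵐ x : EuclideanSpace ℝ (Fin n), ∀ γ ∈ posB n, ⟪x, γ⟫_ℝ ≠ 0 := by
  rw [ae_ball_iff finite_posB.countable]
  intro γ hγ
  have h := Measure.addHaar_submodule (volume : Measure (EuclideanSpace ℝ (Fin n)))
    (LinearMap.ker (innerₗ _ γ)) (fun htop => by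
      have h1 := one_le_inner_rhoB hγ
      have h2 : rhoB n ∈ LinearMap.ker (innerₗ _ γ) := htop ▸ Submodule.mem_top
      rw [LinearMap.mem_ker, innerₗ_apply_apply, real_inner_comm] at h2
      linarith)
  rw [ae_iff]
  refine measure_mono_null (fun x hx => ?_) h
  simpa [real_inner_comm] using hx

theorem mem_orderSimplex_of_inner_pos {x : EuclideanSpace ℝ (Fin n)}
    (hx : ∀ γ ∈ posB n, 0 < ⟪x, γ⟫_ℝ) : x ∈ unitCube n → x ∈ orderSimplex n := by
  intro hc j hj
  rcases j with _ | j
  · by_cases h : 0 < n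
    · simpa [padCoord, h] using (abs_le.1 (hc ⟨0, h⟩)).2
    · simp [padCoord, h]
  · by_cases h : j + 1 < n
    · have h1 := hx _ (Or.inl ⟨⟨j, hj⟩, ⟨j + 1, h⟩, Fin.lt_def.2 (Nat.lt_succ_self j), Or.inl rfl⟩)
      rw [inner_sub_right, inner_eB_right, inner_eB_right, sub_pos] at h1
      have hj' : j < n := hj
      simpa [padCoord, h, hj'] using h1.le
    · have h1 := hx _ (Or.inr ⟨⟨j, hj⟩, rfl⟩)
      rw [inner_eB_right] at h1
      have hj' : j < n := hj
      simpa [padCoord, h, hj'] using h1.le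

theorem inner_nonneg_of_antitone {x : EuclideanSpace ℝ (Fin n)} (h0 : ∀ i, 0 ≤ x i)
    (ha : ∀ i j, i ≤ j → x j ≤ x i) {γ : EuclideanSpace ℝ (Fin n)} (hγ : γ ∈ posB n) :
    0 ≤ ⟪x, γ⟫_ℝ := by
  rcases hγ with ⟨i, j, hij, rfl | rfl⟩ | ⟨i, rfl⟩
  · rw [inner_sub_right, inner_eB_right, inner_eB_right]
    exact sub_nonneg.2 (ha i j hij.le)
  · rw [inner_add_right, inner_eB_right, inner_eB_right]
    exact add_nonneg (h0 i) (h0 j)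
  · rw [inner_eB_right]
    exact h0 i

theorem inner_nonneg_of_mem_orderSimplex {x : EuclideanSpace ℝ (Fin n)} (hx : x ∈ orderSimplex n)
    {γ : EuclideanSpace ℝ (Fin n)} (hγ : γ ∈ posB n) : 0 ≤ ⟪x, γ⟫_ℝ := by
  refine inner_nonneg_of_antitone (fun i => ?_) (fun i j hij => ?_) hγ
  · rw [← padCoord_succ 1 x i]
    exact (padCoord_mem_Icc hx (by omega)).1
  · have key : ∀ a b : ℕ, a ≤ b → b ≤ n + 1 → padCoord 1 x b ≤ padCoord 1 x a := by
      intro a b hab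
      induction b, hab using Nat.le_induction with
      | base => exact fun _ => le_rfl
      | succ b _ ih => exact fun hb => (hx b (by omega)).trans (ih (by omega))
    rw [← padCoord_succ 1 x i, ← padCoord_succ 1 x j]
    have : (i : ℕ) ≤ j := hij
    exact key _ _ (by omega) (by omega)

theorem dominantAlcove_ae_eq : dominantAlcove n =ᵐ[volume] orderSimplex n := by
  filter_upwards [ae_inner_posB_ne_zero] with x hx
  refine propext ⟨fun h => mem_orderSimplex_of_inner_pos h.1 h.2, fun h => ⟨fun γ hγ => ?_, ?_⟩⟩
  · exact lt_of_le_of_ne (inner_nonneg_of_mem_orderSimplex h hγ) (hx γ hγ).symm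
  · exact orderSimplex_subset_unitCube h

theorem isOpen_inner_posB_pos :
    IsOpen {x : EuclideanSpace ℝ (Fin n) | ∀ γ ∈ posB n, 0 < ⟪x, γ⟫_ℝ} := by
  have : {x : EuclideanSpace ℝ (Fin n) | ∀ γ ∈ posB n, 0 < ⟪x, γ⟫_ℝ} =
      ⋂ γ ∈ posB n, {x | 0 < ⟪x, γ⟫_ℝ} := by
    ext x
    simp
  rw [this]
  exact finite_posB.isOpen_biInter fun γ _ => isOpen_lt continuous_const (by fun_prop)

theorem measurableSet_dominantAlcove : MeasurableSet (dominantAlcove n) :=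
  isOpen_inner_posB_pos.measurableSet.inter isCompact_unitCube.isClosed.measurableSet

theorem volume_dominantAlcove_ne_top : volume (dominantAlcove n) ≠ ⊤ :=
  ((measure_mono inter_subset_right).trans_lt isCompact_unitCube.measure_lt_top).ne

theorem volume_real_dominantAlcove_pos : 0 < volume.real (dominantAlcove n) := by
  refine ENNReal.toReal_pos (ne_of_gt ?_) volume_dominantAlcove_ne_top
  have hopen : IsOpen ({x : EuclideanSpace ℝ (Fin n) | ∀ γ ∈ posB n, 0 < ⟪x, γ⟫_ℝ} ∩
      {x | ∀ i, |x i| < 1}) := by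
    refine isOpen_inner_posB_pos.inter ?_
    have : {x : EuclideanSpace ℝ (Fin n) | ∀ i, |x i| < 1} = ⋂ i, {x | |x i| < 1} := by
      ext x
      simp
    rw [this]
    exact isOpen_iInter_of_finite fun i => isOpen_lt (by fun_prop) continuous_const
  have hn : (0 : ℝ) < n + 1 := by positivity
  have hne : ((n + 1 : ℝ)⁻¹ • rhoB n) ∈
      {x : EuclideanSpace ℝ (Fin n) | ∀ γ ∈ posB n, 0 < ⟪x, γ⟫_ℝ} ∩ {x | ∀ i, |x i| < 1} := by
    refine ⟨fun γ hγ => ?_, fun i => ?_⟩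
    · rw [real_inner_smul_left]
      exact mul_pos (inv_pos.2 hn) (zero_lt_one.trans_le (one_le_inner_rhoB hγ))
    · have h1 : ((i : ℕ) : ℝ) ≤ n := Nat.cast_le.2 i.2.le
      have h2 : (0 : ℝ) ≤ (i : ℕ) := Nat.cast_nonneg _
      rw [PiLp.smul_apply, rhoB_apply, smul_eq_mul, abs_of_nonneg
        (mul_nonneg (inv_pos.2 hn).le (sub_nonneg.2 h1)), inv_mul_lt_iff₀ hn]
      linarith
  exact (hopen.measure_pos volume ⟨_, hne⟩).trans_le
    (measure_mono fun x hx => ⟨hx.1, fun i => (hx.2 i).le⟩)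

theorem integral_dominantAlcove_inner (y : EuclideanSpace ℝ (Fin n)) :
    ∫ x in dominantAlcove n, ⟪x, y⟫_ℝ =
      volume.real (dominantAlcove n) / (n + 1) * ⟪rhoB n, y⟫_ℝ := by
  rw [setIntegral_congr_set dominantAlcove_ae_eq, measureReal_congr dominantAlcove_ae_eq]
  simp only [PiLp.inner_apply, RCLike.inner_apply, conj_trivial]
  rw [integral_finsetSum, Finset.mul_sum]
  · refine Finset.sum_congr rfl fun i _ => ?_
    rw [integral_const_mul, integral_orderSimplex_apply]
    ring
  · intro i _
    refine IntegrableOn.mono_set ?_ orderSimplex_subset_unitCube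
    exact ContinuousOn.integrableOn_compact isCompact_unitCube (by fun_prop)

variable {w : EuclideanSpace ℝ (Fin n) ≃ₗ[ℝ] EuclideanSpace ℝ (Fin n)}

theorem measurePreserving_of_mem_weylB (hw : w ∈ weylB n) : MeasurePreserving w :=
  (w.isometryOfInner (weylB_inner_map_map hw)).measurePreserving

theorem measurableEmbedding_of_mem_weylB (hw : w ∈ weylB n) : MeasurableEmbedding w :=
  (w.isometryOfInner (weylB_inner_map_map hw)).toHomeomorph.measurableEmbedding

theorem volume_real_cell (hw : w ∈ weylB n) :
    volume.real (w ⁻¹' dominantAlcove n) = volume.real (dominantAlcove n) :=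
  (measurePreserving_of_mem_weylB hw).measureReal_preimage
    measurableSet_dominantAlcove.nullMeasurableSet

theorem integral_cell_inner (hw : w ∈ weylB n) (β : EuclideanSpace ℝ (Fin n)) :
    ∫ x in w ⁻¹' dominantAlcove n, ⟪x, β⟫_ℝ =
      volume.real (dominantAlcove n) / (n + 1) * ⟪rhoB n, w β⟫_ℝ := by
  have h := (measurePreserving_of_mem_weylB hw).setIntegral_preimage_emb
    (measurableEmbedding_of_mem_weylB hw) (fun x => ⟪x, w β⟫_ℝ) (dominantAlcove n)
  simp only [weylB_inner_map_map hw] at h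
  rw [h, integral_dominantAlcove_inner]

theorem weylB_map_rootsB (hw : w ∈ weylB n) {α : EuclideanSpace ℝ (Fin n)} (hα : α ∈ rootsB n) :
    w α ∈ posB n ∨ -(w α) ∈ posB n := by
  rcases hα with hα | hα
  · exact weylB_map_posB hw hα
  · simpa [or_comm] using weylB_map_posB hw hα

theorem not_neg_mem_posB {α : EuclideanSpace ℝ (Fin n)} (hα : α ∈ posB n) : -α ∉ posB n := by
  intro h
  have h1 := one_le_inner_rhoB hα
  have h2 := one_le_inner_rhoB h
  rw [inner_neg_right] at h2
  linarith

theorem inner_nonpos_iff_of_mem_cell (hw : w ∈ weylB n) {x α : EuclideanSpace ℝ (Fin n)}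
    (hx : x ∈ w ⁻¹' dominantAlcove n) (hα : α ∈ rootsB n) :
    ⟪x, α⟫_ℝ ≤ 0 ↔ -(w α) ∈ posB n := by
  rw [← weylB_inner_map_map hw]
  constructor
  · intro h
    refine (weylB_map_rootsB hw hα).resolve_left fun h' => ?_
    exact absurd (hx.1 _ h') (not_lt.2 h)
  · intro h
    have := hx.1 _ h
    rw [inner_neg_right] at this
    linarith

theorem inner_nonneg_iff_of_mem_cell (hw : w ∈ weylB n) {x α : EuclideanSpace ℝ (Fin n)}
    (hx : x ∈ w ⁻¹' dominantAlcove n) (hα : α ∈ rootsB n) :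
    0 ≤ ⟪x, α⟫_ℝ ↔ -(w α) ∉ posB n := by
  rw [← weylB_inner_map_map hw]
  constructor
  · intro h h'
    have := hx.1 _ h'
    rw [inner_neg_right] at this
    linarith
  · intro h
    exact (hx.1 _ ((weylB_map_rootsB hw hα).resolve_right h)).le

theorem pairwiseDisjoint_cell {S : Set (EuclideanSpace ℝ (Fin n) ≃ₗ[ℝ] EuclideanSpace ℝ (Fin n))}
    (hS : ∀ w ∈ S, w ∈ weylB n) : S.PairwiseDisjoint fun w => w ⁻¹' dominantAlcove n := by
  intro a ha b hb hab
  refine Set.disjoint_left.2 fun x hxa hxb => hab ?_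
  have h : b * a⁻¹ = 1 := by
    refine weylB_eq_one_of_dominant (mul_mem (hS b hb) (inv_mem (hS a ha))) hxa.1 ?_
    rw [← LinearEquiv.mul_apply, inv_mul_cancel_right]
    exact hxb.1
  exact (mul_inv_eq_one.1 h).symm

theorem ae_eq_biUnion_cell
    {S : Finset (EuclideanSpace ℝ (Fin n) ≃ₗ[ℝ] EuclideanSpace ℝ (Fin n))}
    (hS : ∀ w ∈ S, w ∈ weylB n) {R : Set (EuclideanSpace ℝ (Fin n))} (hR : R ⊆ unitCube n)
    (h : ∀ w ∈ weylB n, ∀ x ∈ w ⁻¹' dominantAlcove n, x ∈ R ↔ w ∈ S) :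
    R =ᵐ[volume] ⋃ w ∈ S, w ⁻¹' dominantAlcove n := by
  filter_upwards [ae_inner_posB_ne_zero] with x hx
  refine propext ⟨fun hxR => ?_, fun hxS => ?_⟩
  · obtain ⟨w, hw, hdom⟩ := exists_weylB_dominant x
    have hcell : x ∈ w ⁻¹' dominantAlcove n := by
      refine ⟨fun γ hγ => lt_of_le_of_ne (hdom γ hγ) ?_, weylB_abs_apply_le hw (hR hxR)⟩
      rw [← weylB_inv_apply_self (w := w) γ, weylB_inner_map_map hw]
      rcases weylB_map_posB (inv_mem hw) hγ with h' | h'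
      · exact (hx _ h').symm
      · have := (hx _ h').symm
        rwa [inner_neg_right, ne_comm, neg_ne_zero, ne_comm] at this
    exact mem_biUnion ((h w hw x hcell).1 hxR) hcell
  · obtain ⟨w, hwS, hcell⟩ := mem_iUnion₂.1 hxS
    exact (h w (hS w hwS) x hcell).2 hwS

theorem volume_real_of_ae_eq_biUnion_cell
    {S : Finset (EuclideanSpace ℝ (Fin n) ≃ₗ[ℝ] EuclideanSpace ℝ (Fin n))}
    (hS : ∀ w ∈ S, w ∈ weylB n) {R : Set (EuclideanSpace ℝ (Fin n))}
    (h : R =ᵐ[volume] ⋃ w ∈ S, w ⁻¹' dominantAlcove n) :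
    volume.real R = S.card * volume.real (dominantAlcove n) := by
  have hfin (w) (hw : w ∈ S) : volume (w ⁻¹' dominantAlcove n) ≠ ⊤ := by
    rw [(measurePreserving_of_mem_weylB (hS w hw)).measure_preimage
      measurableSet_dominantAlcove.nullMeasurableSet]
    exact volume_dominantAlcove_ne_top
  rw [measureReal_congr h, measureReal_biUnion_finset (pairwiseDisjoint_cell hS)
    (fun w hw => (measurePreserving_of_mem_weylB (hS w hw)).measurable measurableSet_dominantAlcove)
    hfin, Finset.sum_congr rfl fun w hw => volume_real_cell (hS w hw), Finset.sum_const,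
    nsmul_eq_mul]

theorem integral_inner_of_ae_eq_biUnion_cell
    {S : Finset (EuclideanSpace ℝ (Fin n) ≃ₗ[ℝ] EuclideanSpace ℝ (Fin n))}
    (hS : ∀ w ∈ S, w ∈ weylB n) {R : Set (EuclideanSpace ℝ (Fin n))} (hR : R ⊆ unitCube n)
    (h : R =ᵐ[volume] ⋃ w ∈ S, w ⁻¹' dominantAlcove n) (β : EuclideanSpace ℝ (Fin n)) :
    ∫ x in R, ⟪x, β⟫_ℝ =
      volume.real (dominantAlcove n) / (n + 1) * ∑ w ∈ S, ⟪rhoB n, w β⟫_ℝ := by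
  have hInt : IntegrableOn (fun x => ⟪x, β⟫_ℝ) (⋃ w ∈ S, w ⁻¹' dominantAlcove n) := by
    refine (IntegrableOn.mono_set ?_ hR).congr_set_ae h.symm
    exact ContinuousOn.integrableOn_compact isCompact_unitCube (by fun_prop)
  rw [setIntegral_congr_set h, integral_biUnion_finset S
    (fun w hw => (measurePreserving_of_mem_weylB (hS w hw)).measurable measurableSet_dominantAlcove)
    (pairwiseDisjoint_cell hS) (fun w hw => hInt.mono_set (subset_iUnion₂_of_subset w hw subset_rfl)),
    Finset.sum_congr rfl fun w hw => integral_cell_inner (hS w hw) β, Finset.mul_sum]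

end Cells

section Assembly

variable {n : ℕ}

theorem exists_dominant_one_le_inner {γ : EuclideanSpace ℝ (Fin n)} (hγ : γ ∈ posB n) :
    ∃ ω ∈ unitCube n, (∀ α ∈ posB n, 0 ≤ ⟪ω, α⟫_ℝ) ∧ 1 ≤ ⟪ω, γ⟫_ℝ := by
  let ω (i : Fin n) : EuclideanSpace ℝ (Fin n) := WithLp.toLp 2 fun j => if j ≤ i then 1 else 0
  have hω (i j : Fin n) : ω i j = if j ≤ i then 1 else 0 := rfl
  have hnn (i j : Fin n) : 0 ≤ ω i j := by
    rw [hω]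
    split_ifs <;> norm_num
  have hcube (i : Fin n) : ω i ∈ unitCube n := by
    intro j
    rw [abs_of_nonneg (hnn i j), hω]
    split_ifs <;> norm_num
  have hdom (i : Fin n) : ∀ α ∈ posB n, 0 ≤ ⟪ω i, α⟫_ℝ := by
    refine fun α hα => inner_nonneg_of_antitone (hnn i) (fun j k hjk => ?_) hα
    rw [hω, hω]
    split_ifs with h1 h2
    · exact le_rfl
    · exact absurd (hjk.trans h1) h2
    · exact zero_le_one
    · exact le_rfl
  rcases hγ with ⟨i, j, hij, rfl | rfl⟩ | ⟨i, rfl⟩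
  · refine ⟨ω i, hcube i, hdom i, ?_⟩
    rw [inner_sub_right, inner_eB_right, inner_eB_right, hω, hω]
    simp [not_le.2 hij]
  · refine ⟨ω i, hcube i, hdom i, ?_⟩
    rw [inner_add_right, inner_eB_right, inner_eB_right, hω, hω]
    simp [not_le.2 hij]
  · refine ⟨ω i, hcube i, hdom i, ?_⟩
    rw [inner_eB_right, hω]
    simp

theorem abs_inner_le_two {x α : EuclideanSpace ℝ (Fin n)} (hx : x ∈ unitCube n)
    (hα : α ∈ rootsB n) : |⟪α, x⟫_ℝ| ≤ 2 := by
  wlog h : α ∈ posB n generalizing α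
  · have := this (α := -α) (Or.inl (hα.resolve_left h)) (hα.resolve_left h)
    rwa [inner_neg_left, abs_neg] at this
  rcases h with ⟨i, j, -, rfl | rfl⟩ | ⟨i, rfl⟩
  · rw [inner_sub_left, inner_eB_left, inner_eB_left]
    exact (abs_sub _ _).trans (by linarith [hx i, hx j])
  · rw [inner_add_left, inner_eB_left, inner_eB_left]
    exact (abs_add_le _ _).trans (by linarith [hx i, hx j])
  · rw [inner_eB_left]
    linarith [hx i]

/-- The part of the cube `[-1, 1]ⁿ` cut out by the sign conditions that define `W_D^A`. -/
def coneB (n : ℕ) (D A : Set (EuclideanSpace ℝ (Fin n))) : Set (EuclideanSpace ℝ (Fin n)) :=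
  unitCube n ∩ {x | (∀ α ∈ D, ⟪x, α⟫_ℝ ≤ 0) ∧ ∀ α ∈ posB n \ A, 0 ≤ ⟪x, α⟫_ℝ}

variable {D A : Set (EuclideanSpace ℝ (Fin n))}

theorem convex_coneB : Convex ℝ (coneB n D A) := by
  refine Convex.inter ?_ ?_
  · have : unitCube n = ⋂ i, ({x | -1 ≤ x i} ∩ {x | x i ≤ 1}) := by
      ext x
      simp [unitCube, abs_le]
    rw [this]
    refine convex_iInter fun i => Convex.inter ?_ ?_
    · exact convex_halfSpace_ge (EuclideanSpace.proj (𝕜 := ℝ) i).toLinearMap.isLinear _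
    · exact convex_halfSpace_le (EuclideanSpace.proj (𝕜 := ℝ) i).toLinearMap.isLinear _
  · intro x hx y hy a b ha hb hab
    refine ⟨fun α hα => ?_, fun α hα => ?_⟩
    · rw [inner_add_left, real_inner_smul_left, real_inner_smul_left]
      exact add_nonpos (mul_nonpos_of_nonneg_of_nonpos ha (hx.1 α hα))
        (mul_nonpos_of_nonneg_of_nonpos hb (hy.1 α hα))
    · rw [inner_add_left, real_inner_smul_left, real_inner_smul_left]
      exact add_nonneg (mul_nonneg ha (hx.2 α hα)) (mul_nonneg hb (hy.2 α hα))

theorem isClosed_coneB : IsClosed (coneB n D A) := by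
  refine isCompact_unitCube.isClosed.inter ?_
  have : {x : EuclideanSpace ℝ (Fin n) | (∀ α ∈ D, ⟪x, α⟫_ℝ ≤ 0) ∧ ∀ α ∈ posB n \ A, 0 ≤ ⟪x, α⟫_ℝ} =
      (⋂ α ∈ D, {x | ⟪x, α⟫_ℝ ≤ 0}) ∩ ⋂ α ∈ posB n \ A, {x | 0 ≤ ⟪x, α⟫_ℝ} := by
    ext x
    simp
  rw [this]
  exact (isClosed_biInter fun α _ => isClosed_le (by fun_prop) continuous_const).inter
    (isClosed_biInter fun α _ => isClosed_le continuous_const (by fun_prop))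

variable {w : EuclideanSpace ℝ (Fin n) ≃ₗ[ℝ] EuclideanSpace ℝ (Fin n)}

theorem mem_coneB_iff_of_mem_cell (hD : D ⊆ A) (hA : A ⊆ posB n) (hw : w ∈ weylB n)
    {x : EuclideanSpace ℝ (Fin n)} (hx : x ∈ w ⁻¹' dominantAlcove n) :
    x ∈ coneB n D A ↔ w ∈ convexB n D A := by
  have hxc : x ∈ unitCube n := by
    have := weylB_abs_apply_le (inv_mem hw) hx.2
    rwa [← LinearEquiv.mul_apply, inv_mul_cancel, LinearEquiv.coe_one, id] at this
  have h1 (α) (hα : α ∈ posB n) := inner_nonpos_iff_of_mem_cell hw hx (Or.inl hα)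
  have h2 (α) (hα : α ∈ posB n) := inner_nonneg_iff_of_mem_cell hw hx (Or.inl hα)
  constructor
  · rintro ⟨-, hxD, hxA⟩
    refine ⟨hw, fun α hα => ⟨hA (hD hα), (h1 α (hA (hD hα))).1 (hxD α hα)⟩, fun α hα => ?_⟩
    by_contra hαA
    exact (h2 α hα.1).1 (hxA α ⟨hα.1, hαA⟩) hα.2
  · rintro ⟨-, hwD, hwA⟩
    refine ⟨hxc, fun α hα => (h1 α (hA (hD hα))).2 (hwD hα).2, fun α hα => ?_⟩
    exact (h2 α hα.1).2 fun h => hα.2 (hwA ⟨hα.1, h⟩)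

theorem inv_apply_mem_coneB (hw : w ∈ convexB n D A) {x : EuclideanSpace ℝ (Fin n)}
    (hx : x ∈ unitCube n) (hdom : ∀ α ∈ posB n, 0 ≤ ⟪x, α⟫_ℝ) : w⁻¹ x ∈ coneB n D A := by
  obtain ⟨hW, hwD, hwA⟩ := hw
  refine ⟨weylB_abs_apply_le (inv_mem hW) hx, fun α hα => ?_, fun α hα => ?_⟩
  · rw [weylB_inner_inv_left hW]
    have := hdom _ (hwD hα).2
    rw [inner_neg_right] at this
    linarith
  · rw [weylB_inner_inv_left hW]
    exact hdom _ ((weylB_map_posB hW hα.1).resolve_right fun h => hα.2 (hwA ⟨hα.1, h⟩))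

/-- If the Weyl vector pairs on average below one and above minus one with `w β` for `w ∈ W_D^A`,
then a proportion at least `1 / (2e)` of the elements of `W_D^A` send `β` to a negative root. -/
theorem card_div_le_card_filter (hn : 2 ≤ n) (hD : D ⊆ A) (hA : A ⊆ posB n)
    {C : Finset (EuclideanSpace ℝ (Fin n) ≃ₗ[ℝ] EuclideanSpace ℝ (Fin n))}
    (hC : ∀ w, w ∈ C ↔ w ∈ convexB n D A) {β : EuclideanSpace ℝ (Fin n)} (hβ : β ∈ rootsB n)
    (hsum : |∑ w ∈ C, ⟪rhoB n, w β⟫_ℝ| < C.card)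
    [DecidablePred fun w : EuclideanSpace ℝ (Fin n) ≃ₗ[ℝ] EuclideanSpace ℝ (Fin n) =>
      -(w β) ∈ posB n] :
    (C.card : ℝ) / (2 * Real.exp 1) ≤ (C.filter fun w => -(w β) ∈ posB n).card := by
  have hCW : ∀ w ∈ C, w ∈ weylB n := fun w hw => ((hC w).1 hw).1
  have hneg : ∃ w ∈ C, -(w β) ∈ posB n := by
    by_contra! hcon
    refine absurd (abs_lt.1 hsum).2 (not_lt.2 ?_)
    have := Finset.card_nsmul_le_sum C (fun w => ⟪rhoB n, w β⟫_ℝ) 1 fun w hw =>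
      one_le_inner_rhoB ((weylB_map_rootsB (hCW w hw) hβ).resolve_right (hcon w hw))
    simpa using this
  have hpos : ∃ w ∈ C, w β ∈ posB n := by
    by_contra! hcon
    refine absurd (abs_lt.1 hsum).1 (not_lt.2 ?_)
    have := Finset.card_nsmul_le_sum C (fun w => ⟪rhoB n, -(w β)⟫_ℝ) 1 fun w hw =>
      one_le_inner_rhoB ((weylB_map_rootsB (hCW w hw) hβ).resolve_left (hcon w hw))
    simp only [inner_neg_right, Finset.sum_neg_distrib] at this
    simpa using neg_le_neg this
  obtain ⟨a, haC, ha⟩ := hneg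
  obtain ⟨b, hbC, hb⟩ := hpos
  obtain ⟨x, hx, hxd, hxa⟩ := exists_dominant_one_le_inner ha
  obtain ⟨y, hy, hyd, hyb⟩ := exists_dominant_one_le_inner hb
  have hv : 0 < volume.real (dominantAlcove n) := volume_real_dominantAlcove_pos
  have hK := ae_eq_biUnion_cell hCW (R := coneB n D A) inter_subset_left fun w hw z hz =>
    (mem_coneB_iff_of_mem_cell hD hA hw hz).trans (hC w).symm
  have hFW : ∀ w ∈ C.filter fun w => -(w β) ∈ posB n, w ∈ weylB n := fun w hw =>
    hCW w (Finset.mem_filter.1 hw).1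
  have hu (z : EuclideanSpace ℝ (Fin n)) : innerSL ℝ β z = ⟪z, β⟫_ℝ := by
    rw [innerSL_apply_apply, real_inner_comm]
  have hKneg := ae_eq_biUnion_cell hFW (R := coneB n D A ∩ {z | innerSL ℝ β z ≤ 0})
    (inter_subset_left.trans inter_subset_left) fun w hw z hz => by
      rw [Finset.mem_filter, hC, ← mem_coneB_iff_of_mem_cell hD hA hw hz,
        ← inner_nonpos_iff_of_mem_cell hw hz hβ, ← hu]
      rfl
  have hvolK := volume_real_of_ae_eq_biUnion_cell hCW hK
  have hvolN := volume_real_of_ae_eq_biUnion_cell hFW hKneg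
  have hmain := volume_halfspace_ge hn (convex_coneB (D := D) (A := A))
    isClosed_coneB.measurableSet
    ((measure_mono inter_subset_left).trans_lt isCompact_unitCube.measure_lt_top).ne
    (innerSL ℝ β) (fun z hz => abs_inner_le_two hz.1 hβ)
    (inv_apply_mem_coneB ((hC a).1 haC) hx hxd) (inv_apply_mem_coneB ((hC b).1 hbC) hy hyd)
    (by
      rw [hu, weylB_inner_inv_left (hCW a haC)]
      rw [inner_neg_right] at hxa
      linarith)
    (by rwa [hu, weylB_inner_inv_left (hCW b hbC)])
    (by
      rw [hvolN]
      refine mul_pos (Nat.cast_pos.2 (Finset.card_pos.2 ⟨a, ?_⟩)) hv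
      exact Finset.mem_filter.2 ⟨haC, ha⟩)
    (by
      simp only [hu]
      rw [integral_inner_of_ae_eq_biUnion_cell (R := coneB n D A) hCW inter_subset_left hK, hvolK,
        mul_comm, mul_div_assoc]
      exact mul_le_mul_of_nonneg_right (abs_lt.1 hsum).2.le (by positivity))
  rw [hvolK, hvolN, mul_div_right_comm] at hmain
  exact le_of_mul_le_mul_right hmain hv

end Assembly

end TypeB

/-- Let `n ≥ 2` and let `W` be the Weyl group of the type `Bₙ` root
system in `ℝⁿ`.  If `C = W_D^A` (`D ⊆ A ⊆ Φ⁺`) is a convex subset with `|C| > 1`, then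
there exists `β ∈ Φ⁺` with `1/(2e) ≤ δ_C(β) ≤ 1 − 1/(2e)`; that is, the balance constant
satisfies `b(C) ≥ 1/(2e)`. -/
theorem stmt17 (n : ℕ) (hn : 2 ≤ n) (D A : Set (EuclideanSpace ℝ (Fin n)))
    (hD : D ⊆ A) (hA : A ⊆ posB n) (hC : 1 < (convexB n D A).ncard) :
    ∃ β ∈ posB n,
      1 / (2 * Real.exp 1) ≤ deltaB n (convexB n D A) β ∧
        deltaB n (convexB n D A) β ≤ 1 - 1 / (2 * Real.exp 1) := by
  classical
  have hfin : (convexB n D A).Finite := Set.finite_of_ncard_pos (zero_lt_one.trans hC)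
  have hmem : ∀ w, w ∈ hfin.toFinset ↔ w ∈ convexB n D A := fun w => hfin.mem_toFinset
  have hcard : (convexB n D A).ncard = hfin.toFinset.card := Set.ncard_eq_toFinset_card _ hfin
  set C := hfin.toFinset
  have hCW : ∀ w ∈ C, w ∈ weylB n := fun w hw => ((hmem w).1 hw).1
  rw [hcard] at hC
  obtain ⟨β, hβ, hsum⟩ := exists_abs_sum_inner_lt_card C hCW hC
  have hneg : {w ∈ convexB n D A | -(w β) ∈ posB n}.ncard =
      (C.filter fun w => -(w β) ∈ posB n).card := by
    rw [← Set.ncard_coe_finset]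
    congr 1
    ext w
    simp [hmem]
  have h1 := card_div_le_card_filter hn hD hA hmem (Or.inl hβ) hsum
  have h2 := card_div_le_card_filter hn hD hA hmem (β := -β)
    (Or.inr (by rwa [Set.mem_neg, neg_neg])) (by simpa using hsum)
  have hsplit : (C.filter fun w => -(w (-β)) ∈ posB n) = C.filter fun w => ¬ -(w β) ∈ posB n := by
    refine Finset.filter_congr fun w hw => ?_
    rw [map_neg, neg_neg]
    refine ⟨not_neg_mem_posB, fun h => ?_⟩
    exact (weylB_map_posB (hCW w hw) hβ).resolve_right h
  rw [hsplit] at h2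
  have hadd : ((C.filter fun w => -(w β) ∈ posB n).card : ℝ) +
      (C.filter fun w => ¬ -(w β) ∈ posB n).card = C.card := by
    exact_mod_cast C.card_filter_add_card_filter_not _
  have hCpos : (0 : ℝ) < C.card := Nat.cast_pos.2 (zero_lt_one.trans hC)
  refine ⟨β, hβ, ?_, ?_⟩
  · rw [deltaB, hneg, hcard, le_div_iff₀ hCpos]
    linarith [div_eq_mul_one_div (C.card : ℝ) (2 * Real.exp 1)]
  · rw [deltaB, hneg, hcard, div_le_iff₀ hCpos]
    linarith [div_eq_mul_one_div (C.card : ℝ) (2 * Real.exp 1)]
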